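/- Let K be an imaginary quadratic field and O_K its ring of integers. There does not exist a Diophantine m-tuple with D(-1) in O_K for any m > 36; i.e., there is no set of more than 36 nonzero elements of O_K such that the product of any two distinct elements, minus 1, is a square in O_K. -/

import Mathlib

namespace DTup

/-- half-integer binomial coefficient -/
noncomputable def bc (k l : ℕ) : ℂ := Ring.choose ((k : ℂ) + 1 / 2) l

lemma choose_succ_mul (r : ℂ) (l : ℕ) :
    ((l : ℂ) + 1) * Ring.choose r (l + 1) = (r - l) * Ring.choose r l := by
  have h := Ring.choose_smul_choose r (n := l + 1) (k := l) (Nat.le_succ l)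
  simp at h
  rw [← Nat.cast_succ] at *
  simpa [mul_comm] using h

lemma choose_trinom (r : ℂ) (l h : ℕ) :
    Ring.choose r (l + h) * (Nat.choose (l + h) l : ℂ)
      = Ring.choose r l * Ring.choose (r - l) h := by
  have := Ring.choose_smul_choose r (n := l + h) (k := l) (Nat.le_add_right _ _)
  simp at this
  rw [← this]; ring

lemma binom_hasSum (a u : ℂ) (hu : ‖u‖ < 1) :
    HasSum (fun h => Ring.choose a h * u ^ h) ((1 + u) ^ a) := by
  have h := (Complex.one_add_cpow_hasFPowerSeriesOnBall_zero (a := a)).hasSum (y := u)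
    (by
      rw [← ENNReal.ofReal_one, Metric.eball_ofReal]
      simpa using hu)
  simpa [binomialSeries, FormalMultilinearSeries.coeff_ofScalars, mul_comm] using h

lemma bc_norm_le (k l : ℕ) (hl : l ≤ k + 1) : ‖bc k l‖ ≤ (Nat.choose (k + 1) l : ℝ) := by
  induction l with
  | zero => simp [bc]
  | succ l ih =>
    have h1 := choose_succ_mul ((k : ℂ) + 1 / 2) l
    have h2 := congrArg norm h1
    rw [norm_mul, norm_mul] at h2
    have h3 : ‖(l : ℂ) + 1‖ = (l : ℝ) + 1 := by
      have : ((l : ℂ) + 1) = (((l : ℝ) + 1 : ℝ) : ℂ) := by push_cast; rfl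
      rw [this, Complex.norm_real, Real.norm_of_nonneg (by positivity)]
    have hlk : (l : ℝ) ≤ k := by exact_mod_cast Nat.succ_le_succ_iff.mp hl
    have h4 : ‖(k : ℂ) + 1 / 2 - l‖ ≤ (k : ℝ) + 1 - l := by
      have : ((k : ℂ) + 1 / 2 - l) = (((k : ℝ) + 1 / 2 - l : ℝ) : ℂ) := by push_cast; rfl
      rw [this, Complex.norm_real, Real.norm_of_nonneg (by linarith)]
      linarith
    have h5 : ((l : ℝ) + 1) * (Nat.choose (k + 1) (l + 1)) = ((k : ℝ) + 1 - l) * Nat.choose (k + 1) l := by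
      have := Nat.choose_succ_right_eq (k + 1) l
      have h6 : ((k + 1 - l : ℕ) : ℝ) = (k : ℝ) + 1 - l := by
        rw [Nat.cast_sub (by omega)]; push_cast; ring
      rw [← h6]
      have h7 : (((k + 1).choose (l + 1) * (l + 1) : ℕ) : ℝ) = ((k + 1).choose l * (k + 1 - l) : ℕ) := by
        rw [this]
      push_cast at h7 ⊢
      linarith
    rw [h3] at h2
    have ih' := ih (by omega)
    have h8 : ((l : ℝ) + 1) * ‖bc k (l + 1)‖ ≤ ((l : ℝ) + 1) * (Nat.choose (k + 1) (l + 1)) := by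
      rw [h5]
      unfold bc at *
      rw [h2]
      apply mul_le_mul h4 ih' (norm_nonneg _) (by linarith)
    exact le_of_mul_le_mul_left h8 (by positivity)

lemma bc_norm_le_one (k l : ℕ) (hl : k + 1 ≤ l) : ‖bc k l‖ ≤ 1 := by
  induction l, hl using Nat.le_induction with
  | base => simpa using bc_norm_le k (k + 1) le_rfl
  | succ l hl ih =>
    have h1 := choose_succ_mul ((k : ℂ) + 1 / 2) l
    have h2 := congrArg norm h1
    rw [norm_mul, norm_mul] at h2
    have h3 : ‖(l : ℂ) + 1‖ = (l : ℝ) + 1 := by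
      have : ((l : ℂ) + 1) = (((l : ℝ) + 1 : ℝ) : ℂ) := by push_cast; rfl
      rw [this, Complex.norm_real, Real.norm_of_nonneg (by positivity)]
    have hlk : (k : ℝ) + 1 ≤ l := by exact_mod_cast hl
    have h4 : ‖(k : ℂ) + 1 / 2 - l‖ ≤ (l : ℝ) + 1 := by
      have : ((k : ℂ) + 1 / 2 - l) = (((k : ℝ) + 1 / 2 - l : ℝ) : ℂ) := by push_cast; rfl
      have hk : (0 : ℝ) ≤ k := by positivity
      rw [this, Complex.norm_real, Real.norm_eq_abs, abs_le]
      constructor <;> linarith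
    rw [h3] at h2
    have h8 : ((l : ℝ) + 1) * ‖bc k (l + 1)‖ ≤ ((l : ℝ) + 1) * 1 := by
      unfold bc at *
      rw [h2]
      apply mul_le_mul h4 ih (norm_nonneg _) (by positivity)
    exact le_of_mul_le_mul_left h8 (by positivity)

lemma choose_neg_half (l : ℕ) :
    (4 : ℂ) ^ l * Ring.choose (-1 / 2 : ℂ) l = (-1) ^ l * (Nat.centralBinom l : ℂ) := by
  induction l with
  | zero => simp
  | succ l ih =>
    have h1 := choose_succ_mul (-1 / 2 : ℂ) l
    have h2 : (((l + 1) * Nat.centralBinom (l + 1) : ℕ) : ℂ) = (2 * (2 * l + 1) * Nat.centralBinom l : ℕ) := by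
      rw [Nat.succ_mul_centralBinom_succ]
    push_cast at h2
    have h0 : (l : ℂ) + 1 ≠ 0 := by exact_mod_cast Nat.succ_ne_zero l
    apply mul_left_cancel₀ h0
    linear_combination (4 : ℂ) ^ (l + 1) * h1 - (-1) ^ (l + 1) * h2 + 4 * (-1 / 2 - (l : ℂ)) * ih

lemma choose_half_int (k l : ℕ) :
    ∃ n : ℤ, (4 : ℂ) ^ l * Ring.choose ((k : ℂ) - 1 / 2) l = n := by
  induction k generalizing l with
  | zero =>
    refine ⟨(-1) ^ l * (Nat.centralBinom l : ℤ), ?_⟩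
    have := choose_neg_half l
    push_cast
    rw [← this]
    norm_num
  | succ k ih =>
    cases l with
    | zero => exact ⟨1, by simp⟩
    | succ l =>
      obtain ⟨m, hm⟩ := ih l
      obtain ⟨n, hn⟩ := ih (l + 1)
      refine ⟨4 * m + n, ?_⟩
      have : ((k + 1 : ℕ) : ℂ) - 1 / 2 = ((k : ℂ) - 1 / 2) + 1 := by push_cast; ring
      rw [this, Ring.choose_succ_succ]
      push_cast
      rw [← hm, ← hn]; ring

lemma bc_int (k l : ℕ) : ∃ n : ℤ, (4 : ℂ) ^ l * bc k l = n := by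
  obtain ⟨n, hn⟩ := choose_half_int (k + 1) l
  refine ⟨n, ?_⟩
  rw [← hn]; unfold bc; push_cast; ring_nf

lemma bc_succ (k l : ℕ) : ((l : ℂ) + 1) * bc k (l + 1) = ((k : ℂ) + 1 / 2 - l) * bc k l :=
  choose_succ_mul _ _

end DTup

namespace DTup
open PowerSeries

/-- local expansion of `t - q` at `p` -/
noncomputable def nu (p q : ℂ) : ℂ⟦X⟧ := C (p - q) + X

lemma nu_self (p : ℂ) : nu p p = X := by simp [nu]

lemma nu_mul_inv {p q : ℂ} (h : p ≠ q) : nu p q * (nu p q)⁻¹ = 1 := by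
  apply PowerSeries.mul_inv_cancel
  simpa [nu, sub_eq_zero] using h

/-- product of inverses of other factors, with multiplicities -/
noncomputable def Vp (α : Fin 3 → ℂ) (m : Fin 3 → ℕ) (j : Fin 3) : ℂ⟦X⟧ :=
  ∏ u ∈ Finset.univ.erase j, ((nu (α j) (α u))⁻¹) ^ (m u)

/-- sum of residues of `G / ∏ (t - α_u)^(m_u)` -/
noncomputable def V (α : Fin 3 → ℂ) (m : Fin 3 → ℕ) (G : Fin 3 → ℂ⟦X⟧) : ℂ :=
  ∑ j, coeff (m j) (X * (G j * Vp α m j))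

lemma V_add (α : Fin 3 → ℂ) (m : Fin 3 → ℕ) (G H : Fin 3 → ℂ⟦X⟧) :
    V α m (fun j => G j + H j) = V α m G + V α m H := by
  simp only [V, ← Finset.sum_add_distrib, ← map_add]
  refine Finset.sum_congr rfl fun j _ => ?_
  congr 1; ring

lemma V_smul (α : Fin 3 → ℂ) (m : Fin 3 → ℕ) (c : ℂ) (G : Fin 3 → ℂ⟦X⟧) :
    V α m (fun j => C c * G j) = c * V α m G := by
  simp only [V, Finset.mul_sum]
  refine Finset.sum_congr rfl fun j _ => ?_
  rw [← coeff_C_mul]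
  congr 1; ring

lemma V_step {α : Fin 3 → ℂ} (hα : Function.Injective α) (m : Fin 3 → ℕ) (u : Fin 3)
    (G : Fin 3 → ℂ⟦X⟧) :
    V α (m + Pi.single u 1) (fun j => nu (α j) (α u) * G j) = V α m G := by
  unfold V
  refine Finset.sum_congr rfl fun j _ => ?_
  by_cases hj : j = u
  · subst hj
    have h1 : Vp α (m + Pi.single j 1) j = Vp α m j := by
      unfold Vp
      refine Finset.prod_congr rfl fun v hv => ?_
      have : v ≠ j := Finset.ne_of_mem_erase hv
      simp [this]
    rw [h1]
    simp only [nu_self, Pi.add_apply, Pi.single_eq_same]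
    rw [mul_assoc, coeff_succ_X_mul]
  · have hne : α j ≠ α u := fun h => hj (hα h)
    have hu : u ∈ (Finset.univ.erase j : Finset (Fin 3)) := by
      simp [Ne.symm hj]
    have h1 : nu (α j) (α u) * Vp α (m + Pi.single u 1) j = Vp α m j := by
      unfold Vp
      rw [← Finset.mul_prod_erase _ _ hu, ← Finset.mul_prod_erase _ _ hu]
      have h2 : ∏ x ∈ (Finset.univ.erase j).erase u, (nu (α j) (α x))⁻¹ ^ (m + Pi.single u 1 : Fin 3 → ℕ) x
        = ∏ x ∈ (Finset.univ.erase j).erase u, (nu (α j) (α x))⁻¹ ^ m x := by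
        refine Finset.prod_congr rfl fun v hv => ?_
        have : v ≠ u := Finset.ne_of_mem_erase hv
        simp [this]
      rw [h2]
      simp only [Pi.add_apply, Pi.single_eq_same, pow_succ]
      linear_combination (nu (α j) (α u))⁻¹ ^ m u * (∏ x ∈ (Finset.univ.erase j).erase u, (nu (α j) (α x))⁻¹ ^ m x) * nu_mul_inv hne
    rw [← h1]
    simp only [Pi.add_apply, Pi.single_eq_of_ne hj, add_zero]
    congr 1; ring

/-- divided difference of `z^h` -/
noncomputable def Dd (α : Fin 3 → ℂ) (m : Fin 3 → ℕ) (h : ℕ) : ℂ :=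
  V α m (fun j => (C (α j) + X) ^ h)

lemma Dd_succ {α : Fin 3 → ℂ} (hα : Function.Injective α) (m : Fin 3 → ℕ) (u : Fin 3) (h : ℕ) :
    Dd α (m + Pi.single u 1) (h + 1) = α u * Dd α (m + Pi.single u 1) h + Dd α m h := by
  have h1 : (fun j => (C (α j) + X) ^ (h + 1)) =
      (fun j => C (α u) * (C (α j) + X : ℂ⟦X⟧) ^ h + nu (α j) (α u) * (C (α j) + X) ^ h) := by
    funext j
    simp only [nu, map_sub]; ring
  unfold Dd
  rw [h1, V_add, V_smul, V_step hα]

lemma Dd_diff {α : Fin 3 → ℂ} (hα : Function.Injective α) (m : Fin 3 → ℕ) (u v : Fin 3) (h : ℕ) :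
    (α u - α v) * Dd α (m + Pi.single u 1 + Pi.single v 1) h
      = Dd α (m + Pi.single u 1) h - Dd α (m + Pi.single v 1) h := by
  have h1 := Dd_succ hα (m + Pi.single u 1) v h
  have h2 := Dd_succ hα (m + Pi.single v 1) u h
  rw [add_right_comm m (Pi.single v 1)] at h2
  linear_combination h1 - h2

lemma exists_eq_add_single (m : Fin 3 → ℕ) (u : Fin 3) (hu : m u ≠ 0) :
    ∃ m' : Fin 3 → ℕ, m = m' + Pi.single u 1 := by
  refine ⟨Function.update m u (m u - 1), ?_⟩
  funext j
  by_cases hj : j = u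
  · subst hj; simp; omega
  · simp [hj]

lemma sum_add_single (m : Fin 3 → ℕ) (u : Fin 3) :
    ∑ j, (m + Pi.single u 1 : Fin 3 → ℕ) j = ∑ j, m j + 1 := by
  simp [Finset.sum_add_distrib]

lemma Dd_zero {α : Fin 3 → ℂ} (hα : Function.Injective α) (n : ℕ) (m : Fin 3 → ℕ)
    (hm : ∑ j, m j = n) : Dd α m 0 = if n = 1 then 1 else 0 := by
  induction n generalizing m with
  | zero =>
    have : ∀ j, m j = 0 := by simpa using hm
    simp [Dd, V, this]
  | succ n ih =>
    obtain ⟨u, hu⟩ : ∃ u, m u ≠ 0 := by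
      by_contra hcon
      push Not at hcon
      simp [hcon] at hm
    obtain ⟨m', rfl⟩ := exists_eq_add_single m u hu
    rw [sum_add_single] at hm
    by_cases hv : ∃ v, v ≠ u ∧ m' v ≠ 0
    · obtain ⟨v, hvu, hv⟩ := hv
      obtain ⟨m'', rfl⟩ := exists_eq_add_single m' v hv
      rw [sum_add_single] at hm
      have h1 := Dd_diff hα m'' v u 0
      rw [ih (m'' + Pi.single v 1) (by rw [sum_add_single]; omega),
        ih (m'' + Pi.single u 1) (by rw [sum_add_single]; omega), sub_self] at h1
      have h2 : α v - α u ≠ 0 := sub_ne_zero.mpr fun h => hvu (hα h)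
      have h3 := (mul_eq_zero.mp h1).resolve_left h2
      rw [h3, if_neg (by omega)]
    · push Not at hv
      have h4 : ∑ j, m' j = m' u := Finset.sum_eq_single u (fun v _ h => hv v h) (by simp)
      unfold Dd V
      rw [Finset.sum_eq_single u]
      · have h1 : Vp α (m' + Pi.single u 1) u = 1 := by
          unfold Vp
          refine Finset.prod_eq_one fun v hv' => ?_
          have : v ≠ u := Finset.ne_of_mem_erase hv'
          simp [this, hv v this]
        rw [h1]
        have h5 : m' u = n := by omega
        simp only [Pi.add_apply, Pi.single_eq_same, h5, pow_zero, mul_one, coeff_X]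
      · intro v _ hvu
        simp [hvu, hv v hvu]
      · simp

lemma Dd_vanish {α : Fin 3 → ℂ} (hα : Function.Injective α) (h : ℕ) (m : Fin 3 → ℕ)
    (hm : h + 2 ≤ ∑ j, m j) : Dd α m h = 0 := by
  induction h generalizing m with
  | zero => rw [Dd_zero hα _ m rfl, if_neg (by omega)]
  | succ h ih =>
    obtain ⟨u, hu⟩ : ∃ u, m u ≠ 0 := by
      by_contra hcon
      push Not at hcon
      simp [hcon] at hm
    obtain ⟨m', rfl⟩ := exists_eq_add_single m u hu
    have := sum_add_single m' u
    rw [Dd_succ hα, ih _ (by omega), ih m' (by omega)]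
    simp

lemma Dd_bound {α : Fin 3 → ℂ} (hα : Function.Injective α) {R : ℝ} (hR : 1 ≤ R)
    (hαR : ∀ j, ‖α j‖ ≤ R) (h : ℕ) (m : Fin 3 → ℕ) :
    ‖Dd α m h‖ * R ^ (∑ j, m j) ≤ R * (2 * R) ^ h := by
  induction h generalizing m with
  | zero =>
    rw [Dd_zero hα _ m rfl]
    split_ifs with h1
    · rw [h1]; simp
    · simp; linarith
  | succ h ih =>
    by_cases hcon : ∀ u, m u = 0
    · have : Dd α m (h + 1) = 0 := by simp [Dd, V, hcon]
      rw [this]; simp; positivity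
    · push Not at hcon
      obtain ⟨u, hu⟩ := hcon
      obtain ⟨m', rfl⟩ := exists_eq_add_single m u hu
      have h1 := ih (m' + Pi.single u 1)
      have h2 := ih m'
      rw [Dd_succ hα]
      rw [sum_add_single] at h1 ⊢
      have h3 : ‖α u * Dd α (m' + Pi.single u 1) h + Dd α m' h‖ ≤ R * ‖Dd α (m' + Pi.single u 1) h‖ + ‖Dd α m' h‖ := by
        refine (norm_add_le _ _).trans ?_
        rw [norm_mul]
        gcongr
        exact hαR u
      have hR0 : 0 ≤ R := by linarith
      calc _ ≤ (R * ‖Dd α (m' + Pi.single u 1) h‖ + ‖Dd α m' h‖) * R ^ (∑ j, m' j + 1) := by gcongr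
        _ = R * (‖Dd α (m' + Pi.single u 1) h‖ * R ^ (∑ j, m' j + 1)) + R * (‖Dd α m' h‖ * R ^ (∑ j, m' j)) := by ring
        _ ≤ R * (R * (2 * R) ^ h) + R * (R * (2 * R) ^ h) := by gcongr
        _ = _ := by ring

end DTup

namespace DTup
open PowerSeries

/-- local expansion of `t^(k+1/2)/n^(1/2)` at `n` -/
noncomputable def gs (k : ℕ) (n : ℂ) : ℂ⟦X⟧ := PowerSeries.mk fun l => bc k l * n ^ ((k : ℤ) - l)

noncomputable def pj (α : Fin 3 → ℂ) (N : ℂ) (k : ℕ) (j : Fin 3) (m : ℕ) : ℂ :=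
  coeff k (gs k (N + α j) * (C (α j) + X) ^ m * Vp α (fun _ => k + 1) j)

lemma coeff_lin_pow (a : ℂ) (h l : ℕ) :
    coeff l ((C a + X : ℂ⟦X⟧) ^ h) = a ^ (h - l) * (h.choose l : ℂ) := by
  have := Polynomial.coeff_X_add_C_pow a h l
  rw [← this, ← Polynomial.coeff_coe]
  push_cast
  rw [add_comm]

lemma coeff_hasSum (k l : ℕ) (hl : l ≤ k) (N a : ℂ) (hN : ‖a‖ < ‖N‖) :
    HasSum (fun h : ℕ => bc k h * N ^ ((k : ℤ) - h) * coeff l ((C a + X : ℂ⟦X⟧) ^ h))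
      ((1 + a / N) ^ (1 / 2 : ℂ) * coeff l (gs k (N + a))) := by
  have hN0 : N ≠ 0 := by
    intro h; rw [h, norm_zero] at hN; exact absurd (norm_nonneg a) (not_le.mpr hN)
  have hu : ‖a / N‖ < 1 := by
    rw [norm_div, div_lt_one (by positivity)]; exact hN
  have hne : 1 + a / N ≠ 0 := by
    intro h
    have : a / N = -1 := by linear_combination h
    rw [this] at hu; simp at hu
  have h1 := (binom_hasSum ((k : ℂ) + 1 / 2 - l) (a / N) hu).mul_left (bc k l * N ^ ((k : ℤ) - l))
  have hinj : Function.Injective (fun h : ℕ => l + h) := add_right_injective l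
  rw [← hinj.hasSum_iff]
  · have e1 : ((fun h : ℕ => bc k h * N ^ ((k : ℤ) - h) * coeff l ((C a + X : ℂ⟦X⟧) ^ h)) ∘
        (fun h : ℕ => l + h)) = fun h : ℕ => bc k l * N ^ ((k : ℤ) - l) *
          (Ring.choose ((k : ℂ) + 1 / 2 - l) h * (a / N) ^ h) := by
      funext h
      simp only [Function.comp_apply, coeff_lin_pow]
      have h2 := choose_trinom ((k : ℂ) + 1 / 2) l h
      have h3 : l + h - l = h := by omega
      have h4 : N ^ ((k : ℤ) - ((l + h : ℕ) : ℤ)) = N ^ ((k : ℤ) - l) * (N ^ h)⁻¹ := by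
        rw [← zpow_natCast, ← zpow_neg, ← zpow_add₀ hN0]
        congr 1; push_cast; ring
      rw [h3, h4, div_pow]
      unfold bc
      linear_combination N ^ ((k : ℤ) - l) * (N ^ h)⁻¹ * a ^ h * h2
    have e2 : (1 + a / N) ^ (1 / 2 : ℂ) * coeff l (gs k (N + a)) =
        bc k l * N ^ ((k : ℤ) - l) * (1 + a / N) ^ ((k : ℂ) + 1 / 2 - l) := by
      have h5 : (k : ℂ) + 1 / 2 - l = ((k - l : ℕ) : ℂ) + 1 / 2 := by
        rw [Nat.cast_sub hl]; ring
      have h6 : (k : ℤ) - l = ((k - l : ℕ) : ℤ) := by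
        rw [Nat.cast_sub hl]
      rw [h5, Complex.cpow_add _ _ hne, Complex.cpow_natCast]
      simp only [gs, coeff_mk]
      rw [h6, zpow_natCast, zpow_natCast]
      have h7 : N + a = N * (1 + a / N) := by field_simp
      rw [h7, mul_pow]; ring
    rw [e1, e2]; exact h1
  · intro h hh
    have : h < l := by
      by_contra hcon
      exact hh ⟨h - l, by simp; omega⟩
    rw [coeff_lin_pow, Nat.choose_eq_zero_of_lt this]
    simp

lemma local_hasSum (k : ℕ) (N a : ℂ) (hN : ‖a‖ < ‖N‖) (H : ℂ⟦X⟧) :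
    HasSum (fun h : ℕ => bc k h * N ^ ((k : ℤ) - h) * coeff k ((C a + X : ℂ⟦X⟧) ^ h * H))
      ((1 + a / N) ^ (1 / 2 : ℂ) * coeff k (gs k (N + a) * H)) := by
  simp only [coeff_mul, Finset.mul_sum]
  apply hasSum_sum
  intro p hp
  have hp' : p.1 ≤ k := by
    have := Finset.HasAntidiagonal.mem_antidiagonal.mp hp; omega
  have := (coeff_hasSum k p.1 hp' N a hN).mul_right (coeff p.2 H)
  simpa only [mul_assoc] using this

lemma form_hasSum (α : Fin 3 → ℂ) (N : ℂ) (hN : ∀ j, ‖α j‖ < ‖N‖) (k m : ℕ) :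
    HasSum (fun h : ℕ => bc k h * N ^ ((k : ℤ) - h) * Dd α (fun _ => k + 1) (h + m))
      (∑ j, (1 + α j / N) ^ (1 / 2 : ℂ) * pj α N k j m) := by
  simp only [Dd, V, Finset.mul_sum]
  apply hasSum_sum
  intro j _
  have := local_hasSum k N (α j) (hN j) ((C (α j) + X) ^ m * Vp α (fun _ => k + 1) j)
  simp only [coeff_succ_X_mul, pj, pow_add]
  simpa only [mul_assoc] using this

lemma gs_deriv (k : ℕ) (n : ℂ) (hn : n ≠ 0) :
    (C n + X) * (derivative ℂ) (gs k n) = C ((k : ℂ) + 1 / 2) * gs k n := by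
  ext l
  rw [add_mul, map_add, coeff_C_mul, coeff_C_mul]
  have hb := bc_succ k
  cases l with
  | zero =>
    have h := hb 0
    simp only [gs, coeff_derivative, coeff_mk, coeff_zero_X_mul]
    have h2 : n ^ ((k : ℤ) - ((0 : ℕ) : ℤ)) = n * n ^ ((k : ℤ) - 1) := by
      rw [← zpow_one_add₀ hn]; congr 1; push_cast; ring
    have h3 : n ^ ((k : ℤ) - ((0 + 1 : ℕ) : ℤ)) = n ^ ((k : ℤ) - 1) := by norm_num
    rw [h2, h3]
    push_cast at h ⊢
    linear_combination n * n ^ ((k : ℤ) - 1) * h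
  | succ l =>
    have h := hb (l + 1)
    simp only [gs, coeff_derivative, coeff_mk, coeff_succ_X_mul]
    have h2 : n ^ ((k : ℤ) - ((l + 1 : ℕ) : ℤ)) = n * n ^ ((k : ℤ) - ((l + 1 + 1 : ℕ) : ℤ)) := by
      rw [← zpow_one_add₀ hn]; congr 1; push_cast; ring
    rw [h2]
    push_cast at h ⊢
    linear_combination n * n ^ ((k : ℤ) - ((l : ℤ) + 1 + 1)) * h

lemma local_rec (k m : ℕ) (g t ν₁ ν₂ I₁ I₂ : ℂ⟦X⟧)
    (ht : derivative ℂ t = 1) (h1 : derivative ℂ ν₁ = 1) (h2 : derivative ℂ ν₂ = 1)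
    (hI1 : ν₁ * I₁ = 1) (hI2 : ν₂ * I₂ = 1)
    (hg : t * derivative ℂ g = C ((k : ℂ) + 1 / 2) * g) :
    coeff k (g * t ^ m * (I₁ * I₂) ^ (k + 1) *
      (C ((m : ℂ) + k + 3 / 2) * (X * ν₁ * ν₂)
        - C (k : ℂ) * t * (ν₁ * ν₂ + X * ν₂ + X * ν₁))) = 0 := by
  have d1 : derivative ℂ I₁ = - I₁ ^ 2 := by
    have := congrArg (derivative ℂ) hI1
    simp only [Derivation.leibniz, h1, smul_eq_mul, Derivation.map_one_eq_zero] at this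
    linear_combination I₁ * this - (derivative ℂ I₁) * hI1
  have d2 : derivative ℂ I₂ = - I₂ ^ 2 := by
    have := congrArg (derivative ℂ) hI2
    simp only [Derivation.leibniz, h2, smul_eq_mul, Derivation.map_one_eq_zero] at this
    linear_combination I₂ * this - (derivative ℂ I₂) * hI2
  have dJ : ∀ k : ℕ, derivative ℂ ((I₁ * I₂) ^ k) = - C (k : ℂ) * (I₁ * I₂) ^ k * (I₁ + I₂) := by
    intro k
    induction k with
    | zero => simp
    | succ k ih =>
      rw [pow_succ, Derivation.leibniz, Derivation.leibniz, ih, d1, d2]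
      simp only [smul_eq_mul]
      push_cast
      simp only [map_add, map_one]
      ring
  have dt : derivative ℂ (t ^ (m + 1)) = C ((m : ℂ) + 1) * t ^ m := by
    rw [Derivation.leibniz_pow, ht]
    simp
  set Y := t ^ (m + 1) * g * (I₁ * I₂) ^ k with hY
  have dY : X * derivative ℂ Y - C (k : ℂ) * Y = g * t ^ m * (I₁ * I₂) ^ (k + 1) *
      (C ((m : ℂ) + k + 3 / 2) * (X * ν₁ * ν₂)
        - C (k : ℂ) * t * (ν₁ * ν₂ + X * ν₂ + X * ν₁)) := by
    have e0 : (I₁ * I₂) ^ (k + 1) * (ν₁ * ν₂) = (I₁ * I₂) ^ k := by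
      rw [pow_succ]; linear_combination (I₁ * I₂) ^ k * (ν₂ * I₂ * hI1 + hI2)
    have e1 : (I₁ * I₂) ^ (k + 1) * ν₁ = (I₁ * I₂) ^ k * I₂ := by
      rw [pow_succ]; linear_combination (I₁ * I₂) ^ k * I₂ * hI1
    have e2 : (I₁ * I₂) ^ (k + 1) * ν₂ = (I₁ * I₂) ^ k * I₁ := by
      rw [pow_succ]; linear_combination (I₁ * I₂) ^ k * I₁ * hI2
    rw [hY, Derivation.leibniz, Derivation.leibniz, dJ, dt]
    simp only [smul_eq_mul]
    have e3 : (C ((m : ℂ) + k + 3 / 2) : ℂ⟦X⟧) = C ((m : ℂ) + 1) + C ((k : ℂ) + 1 / 2) := by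
      rw [← map_add]; congr 1; ring
    rw [e3]
    generalize (I₁ * I₂) ^ (k + 1) = J1 at *
    generalize (I₁ * I₂) ^ k = J at *
    generalize (C ((k : ℂ) + 1 / 2) : ℂ⟦X⟧) = c1 at *
    generalize (C ((m : ℂ) + 1) : ℂ⟦X⟧) = c2 at *
    generalize (C (k : ℂ) : ℂ⟦X⟧) = c3 at *
    linear_combination X * J * t ^ m * hg - g * t ^ m * ((c2 + c1) * X - c3 * t) * e0 + c3 * t * g * t ^ m * X * (e1 + e2)
  rw [← dY, map_sub, coeff_C_mul]
  cases k with
  | zero => simp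
  | succ k =>
    rw [coeff_succ_X_mul, coeff_derivative]
    push_cast; ring

end DTup

namespace DTup
open PowerSeries

noncomputable def ev (p : ℂ) : Polynomial ℂ →+* ℂ⟦X⟧ :=
  Polynomial.eval₂RingHom (C : ℂ →+* ℂ⟦X⟧) (C p + X)

lemma ev_X (p : ℂ) : ev p Polynomial.X = C p + X := by simp [ev]
lemma ev_C (p a : ℂ) : ev p (Polynomial.C a) = C a := by simp [ev]
lemma ev_lin (p q : ℂ) : ev p (Polynomial.X - Polynomial.C q) = nu p q := by
  rw [map_sub, ev_X, ev_C, nu, map_sub]; ring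

lemma nu_shift (N p q : ℂ) : nu (N + p) (N + q) = nu p q := by
  simp [nu]

lemma deriv_nu (p q : ℂ) : derivative ℂ (nu p q) = 1 := by
  ext l
  simp [nu, coeff_one]

lemma deriv_t (p : ℂ) : derivative ℂ (C p + X : ℂ⟦X⟧) = 1 := by
  simp

lemma Vp_zero (α : Fin 3 → ℂ) (k : ℕ) : Vp α (fun _ => k) 0 =
    ((nu (α 0) (α 1))⁻¹ * (nu (α 0) (α 2))⁻¹) ^ k := by
  have : (Finset.univ.erase 0 : Finset (Fin 3)) = {1, 2} := by decide
  rw [Vp, this, Finset.prod_pair (by decide), mul_pow]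
lemma Vp_one (α : Fin 3 → ℂ) (k : ℕ) : Vp α (fun _ => k) 1 =
    ((nu (α 1) (α 0))⁻¹ * (nu (α 1) (α 2))⁻¹) ^ k := by
  have : (Finset.univ.erase 1 : Finset (Fin 3)) = {0, 2} := by decide
  rw [Vp, this, Finset.prod_pair (by decide), mul_pow]
lemma Vp_two (α : Fin 3 → ℂ) (k : ℕ) : Vp α (fun _ => k) 2 =
    ((nu (α 2) (α 0))⁻¹ * (nu (α 2) (α 1))⁻¹) ^ k := by
  have : (Finset.univ.erase 2 : Finset (Fin 3)) = {0, 1} := by decide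
  rw [Vp, this, Finset.prod_pair (by decide), mul_pow]

/-- the polynomial functional at one node -/
noncomputable def Lf (k : ℕ) (p : ℂ) (W : ℂ⟦X⟧) (Q : Polynomial ℂ) : ℂ :=
  coeff k (gs k p * ev p Q * W)

lemma Lf_add (k p W Q R) : Lf k p W (Q + R) = Lf k p W Q + Lf k p W R := by
  simp [Lf, mul_add, add_mul]

lemma Lf_C (k p W a Q) : Lf k p W (Polynomial.C a * Q) = a * Lf k p W Q := by
  rw [Lf, Lf, map_mul (ev p), ev_C, ← coeff_C_mul]
  congr 1; ring

open Polynomial in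
noncomputable def recPoly (k m : ℕ) (p q r : ℂ) : Polynomial ℂ :=
  Polynomial.X ^ m * (Polynomial.C ((m : ℂ) + k + 3 / 2) *
      ((Polynomial.X - Polynomial.C p) * (Polynomial.X - Polynomial.C q) * (Polynomial.X - Polynomial.C r))
    - Polynomial.C (k : ℂ) * Polynomial.X *
      ((Polynomial.X - Polynomial.C q) * (Polynomial.X - Polynomial.C r)
      + (Polynomial.X - Polynomial.C p) * (Polynomial.X - Polynomial.C r)
      + (Polynomial.X - Polynomial.C p) * (Polynomial.X - Polynomial.C q)))

lemma Lf_rec (k m : ℕ) (p q r : ℂ) (hp : p ≠ 0) (hq : p ≠ q) (hr : p ≠ r) :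
    Lf k p (((nu p q)⁻¹ * (nu p r)⁻¹) ^ (k + 1)) (recPoly k m p q r) = 0 := by
  have h := local_rec k m (gs k p) (C p + X) (nu p q) (nu p r) (nu p q)⁻¹ (nu p r)⁻¹
    (deriv_t p) (deriv_nu _ _) (deriv_nu _ _) (nu_mul_inv hq) (nu_mul_inv hr) (gs_deriv k p hp)
  rw [← h, Lf, recPoly]
  congr 1
  simp only [map_mul, map_sub (ev p) (_ * _), map_pow, map_add (ev p) (_ + _), map_add (ev p) (_ * _) (_ * _), ev_lin, ev_X, ev_C, nu_self]
  ring

lemma recPoly_swap1 (k m : ℕ) (p q r : ℂ) : recPoly k m q p r = recPoly k m p q r := by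
  unfold recPoly; ring
lemma recPoly_swap2 (k m : ℕ) (p q r : ℂ) : recPoly k m r p q = recPoly k m p q r := by
  unfold recPoly; ring

open Polynomial in
lemma recPoly_expand (k m : ℕ) (p q r : ℂ) : ∃ x y z : ℂ, recPoly k m p q r =
    Polynomial.C ((m : ℂ) + 3 / 2 - 2 * k) * Polynomial.X ^ (m + 3)
      + (Polynomial.C x * Polynomial.X ^ (m + 2) + (Polynomial.C y * Polynomial.X ^ (m + 1)
      + Polynomial.C z * Polynomial.X ^ m)) := by
  refine ⟨-((m : ℂ) + k + 3 / 2) * (p + q + r) + 2 * k * (p + q + r),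
    ((m : ℂ) + k + 3 / 2) * (p * q + q * r + p * r) - k * (p * q + q * r + p * r),
    -((m : ℂ) + k + 3 / 2) * (p * q * r), ?_⟩
  unfold recPoly
  simp only [map_add, map_mul, map_sub, map_neg, map_natCast, map_ofNat]
  generalize (Polynomial.C (3 / 2 : ℂ)) = c
  ring

lemma nonvanish (α : Fin 3 → ℂ) (hα : Function.Injective α) (N : ℂ) (hN : ∀ j, N + α j ≠ 0)
    (k : ℕ) (v : Fin 3 → ℂ) (h : ∀ m ≤ 2, ∑ j, v j * pj α N k j m = 0) : ∀ j, v j = 0 := by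
  let Φ : Polynomial ℂ → ℂ := fun Q =>
    ∑ j, v j * Lf k (N + α j) (Vp α (fun _ => k + 1) j) Q
  have Φadd : ∀ Q R, Φ (Q + R) = Φ Q + Φ R := by
    intro Q R; simp only [Φ, Lf_add, mul_add, Finset.sum_add_distrib]
  have ΦC : ∀ a Q, Φ (Polynomial.C a * Q) = a * Φ Q := by
    intro a Q; simp only [Φ, Lf_C, Finset.mul_sum]
    exact Finset.sum_congr rfl fun j _ => by ring
  have n01 : α 0 ≠ α 1 := fun e => by simpa using hα e
  have n02 : α 0 ≠ α 2 := fun e => by simpa using hα e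
  have n12 : α 1 ≠ α 2 := fun e => by simpa using hα e
  have Φrec : ∀ m, Φ (recPoly k m (N + α 0) (N + α 1) (N + α 2)) = 0 := by
    intro m
    simp only [Φ, Fin.sum_univ_three]
    have r0 := Lf_rec k m (N + α 0) (N + α 1) (N + α 2) (hN 0) (by simpa using n01) (by simpa using n02)
    have r1 := Lf_rec k m (N + α 1) (N + α 0) (N + α 2) (hN 1) (by simpa using n01.symm) (by simpa using n12)
    have r2 := Lf_rec k m (N + α 2) (N + α 0) (N + α 1) (hN 2) (by simpa using n02.symm) (by simpa using n12.symm)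
    rw [recPoly_swap1] at r1
    rw [recPoly_swap2] at r2
    simp only [nu_shift] at r0 r1 r2
    rw [Vp_zero, Vp_one, Vp_two, r0, r1, r2]; simp
  have hpj : ∀ m ≤ 2, Φ ((Polynomial.X - Polynomial.C N) ^ m) = 0 := by
    intro m hm
    rw [← h m hm]
    simp only [Φ]
    refine Finset.sum_congr rfl fun j _ => ?_
    rw [Lf, pj, map_pow, ev_lin]
    simp [nu]
  have Φpow : ∀ m, Φ (Polynomial.X ^ m) = 0 := by
    have h0 : Φ (Polynomial.X ^ 0) = 0 := by simpa using hpj 0 (by norm_num)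
    have h1 : Φ (Polynomial.X ^ 1) = 0 := by
      have := hpj 1 (by norm_num)
      have e : (Polynomial.X ^ 1 : Polynomial ℂ) = (Polynomial.X - Polynomial.C N) ^ 1 + Polynomial.C N * Polynomial.X ^ 0 := by ring
      rw [e, Φadd, ΦC, this, h0]; simp
    have h2 : Φ (Polynomial.X ^ 2) = 0 := by
      have := hpj 2 (by norm_num)
      have e : (Polynomial.X ^ 2 : Polynomial ℂ) = (Polynomial.X - Polynomial.C N) ^ 2 +
          (Polynomial.C (2 * N) * Polynomial.X ^ 1 + Polynomial.C (-N * N) * Polynomial.X ^ 0) := by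
        simp only [map_mul, map_neg, map_ofNat]; ring
      rw [e, Φadd, Φadd, ΦC, ΦC, this, h0, h1]; simp
    intro m
    induction m using Nat.strong_induction_on with
    | _ m ih =>
      match m with
      | 0 => exact h0
      | 1 => exact h1
      | 2 => exact h2
      | m + 3 =>
        obtain ⟨x, y, z, e⟩ := recPoly_expand k m (N + α 0) (N + α 1) (N + α 2)
        have hr := Φrec m
        rw [e, Φadd, Φadd, Φadd, ΦC, ΦC, ΦC, ΦC, ih (m + 2) (by omega), ih (m + 1) (by omega),
          ih m (by omega)] at hr
        simp only [mul_zero, add_zero, mul_eq_zero] at hr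
        rcases hr with hr | hr
        · exfalso
          have h3 : ((2 * m + 3 : ℕ) : ℂ) = ((4 * k : ℕ) : ℂ) := by
            push_cast; linear_combination 2 * hr
          have := Nat.cast_injective h3
          omega
        · exact hr
  have Φz : ∀ Q, Φ Q = 0 := by
    intro Q
    induction Q using Polynomial.induction_on' with
    | add p q hp hq => rw [Φadd, hp, hq, add_zero]
    | monomial n a => rw [← Polynomial.C_mul_X_pow_eq_monomial, ΦC, Φpow, mul_zero]
  have key : ∀ (p q r : ℂ) (W : ℂ⟦X⟧), Lf k p W ((Polynomial.X - Polynomial.C q) ^ k *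
      ((Polynomial.X - Polynomial.C p) * (Polynomial.X - Polynomial.C r)) ^ (k + 1)) = 0 := by
    intro p q r W
    rw [Lf, map_mul (ev p), map_pow (ev p), map_pow (ev p), map_mul (ev p), ev_lin, ev_lin, ev_lin, nu_self, mul_pow]
    have : gs k p * (nu p q ^ k * (X ^ (k + 1) * nu p r ^ (k + 1))) * W =
      X ^ (k + 1) * (gs k p * (nu p q ^ k * nu p r ^ (k + 1)) * W) := by ring
    rw [this, coeff_X_pow_mul', if_neg (by omega)]
  have key2 : ∀ (p q r : ℂ), p ≠ q → p ≠ r → Lf k p (((nu p q)⁻¹ * (nu p r)⁻¹) ^ (k + 1))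
      ((Polynomial.X - Polynomial.C p) ^ k *
      ((Polynomial.X - Polynomial.C q) * (Polynomial.X - Polynomial.C r)) ^ (k + 1)) = p ^ k := by
    intro p q r hq hr
    rw [Lf, map_mul (ev p), map_pow (ev p), map_pow (ev p), map_mul (ev p), ev_lin, ev_lin, ev_lin, nu_self]
    have : gs k p * (X ^ k * (nu p q * nu p r) ^ (k + 1)) * ((nu p q)⁻¹ * (nu p r)⁻¹) ^ (k + 1) =
      X ^ k * gs k p * ((nu p q * (nu p q)⁻¹) * (nu p r * (nu p r)⁻¹)) ^ (k + 1) := by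
        simp only [mul_pow]; ring
    rw [this, nu_mul_inv hq, nu_mul_inv hr]
    simp [coeff_X_pow_mul', gs, bc]
  have s01 : N + α 0 ≠ N + α 1 := by simpa using n01
  have s02 : N + α 0 ≠ N + α 2 := by simpa using n02
  have s12 : N + α 1 ≠ N + α 2 := by simpa using n12
  intro j
  fin_cases j
  · have hz := Φz ((Polynomial.X - Polynomial.C (N + α 0)) ^ k *
      ((Polynomial.X - Polynomial.C (N + α 1)) * (Polynomial.X - Polynomial.C (N + α 2))) ^ (k + 1))
    simp only [Φ, Fin.sum_univ_three] at hz
    rw [key, mul_comm (Polynomial.X - Polynomial.C (N + α 1)), key, mul_comm (Polynomial.X - Polynomial.C (N + α 2)),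
      Vp_zero, ← nu_shift N (α 0) (α 1), ← nu_shift N (α 0) (α 2), key2 _ _ _ s01 s02] at hz
    simpa [hN] using hz
  · have hz := Φz ((Polynomial.X - Polynomial.C (N + α 1)) ^ k *
      ((Polynomial.X - Polynomial.C (N + α 0)) * (Polynomial.X - Polynomial.C (N + α 2))) ^ (k + 1))
    simp only [Φ, Fin.sum_univ_three] at hz
    rw [key, mul_comm (Polynomial.X - Polynomial.C (N + α 0)), key, mul_comm (Polynomial.X - Polynomial.C (N + α 2)),
      Vp_one, ← nu_shift N (α 1) (α 0), ← nu_shift N (α 1) (α 2), key2 _ _ _ s01.symm s12] at hz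
    simpa [hN] using hz
  · have hz := Φz ((Polynomial.X - Polynomial.C (N + α 2)) ^ k *
      ((Polynomial.X - Polynomial.C (N + α 0)) * (Polynomial.X - Polynomial.C (N + α 1))) ^ (k + 1))
    simp only [Φ, Fin.sum_univ_three] at hz
    rw [key, mul_comm (Polynomial.X - Polynomial.C (N + α 0)), key, mul_comm (Polynomial.X - Polynomial.C (N + α 1)),
      Vp_two, ← nu_shift N (α 2) (α 0), ← nu_shift N (α 2) (α 1), key2 _ _ _ s02.symm s12.symm] at hz
    simpa [hN] using hz

end DTup

namespace DTup
open PowerSeries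

lemma nu_inv_coeff {p q : ℂ} (h : p ≠ q) (l : ℕ) :
    coeff l (nu p q)⁻¹ = (-1) ^ l * (p - q)⁻¹ ^ (l + 1) := by
  have hd : p - q ≠ 0 := sub_ne_zero.mpr h
  have hm := nu_mul_inv h
  induction l with
  | zero =>
    have := congrArg (coeff 0) hm
    rw [nu, add_mul, map_add, coeff_C_mul, coeff_zero_X_mul] at this
    simp only [coeff_zero_one, add_zero] at this
    rw [pow_zero, one_mul, zero_add, pow_one]
    exact eq_inv_of_mul_eq_one_right this
  | succ l ih =>
    have := congrArg (coeff (l + 1)) hm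
    rw [nu, add_mul, map_add, coeff_C_mul, coeff_succ_X_mul] at this
    rw [coeff_one, if_neg (by omega)] at this
    change (p - q) * coeff (l + 1) (nu p q)⁻¹ + coeff l (nu p q)⁻¹ = 0 at this
    rw [ih] at this
    have h2 : coeff (l + 1) (nu p q)⁻¹ = (p - q)⁻¹ * ((p - q) * coeff (l + 1) (nu p q)⁻¹) := by
      rw [← mul_assoc, inv_mul_cancel₀ hd, one_mul]
    rw [h2, eq_neg_of_add_eq_zero_left this]
    ring

def IntP (O : Subring ℂ) (E : ℂ) (k : ℕ) (G : ℂ⟦X⟧) : Prop :=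
  ∀ l ≤ k, coeff l G * E ^ l ∈ O

lemma IntP.mul {O E k G H} (hG : IntP O E k G) (hH : IntP O E k H) : IntP O E k (G * H) := by
  intro l hl
  rw [coeff_mul, Finset.sum_mul]
  refine O.sum_mem fun p hp => ?_
  have hp' := Finset.HasAntidiagonal.mem_antidiagonal.mp hp
  have : coeff p.1 G * coeff p.2 H * E ^ l = (coeff p.1 G * E ^ p.1) * (coeff p.2 H * E ^ p.2) := by
    rw [← hp', pow_add]; ring
  rw [this]
  exact O.mul_mem (hG _ (by omega)) (hH _ (by omega))

lemma IntP.add {O E k G H} (hG : IntP O E k G) (hH : IntP O E k H) : IntP O E k (G + H) := by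
  intro l hl
  rw [map_add, add_mul]
  exact O.add_mem (hG l hl) (hH l hl)

lemma IntP.C {O E k a} (ha : a ∈ O) : IntP O E k (C a) := by
  intro l hl
  rw [coeff_C]
  split_ifs with h
  · subst h; simpa using ha
  · simp [O.zero_mem]

lemma IntP.X {O E k} (hE : E ∈ O) : IntP O E k (X : ℂ⟦X⟧) := by
  intro l hl
  rw [coeff_X]
  split_ifs with h
  · rw [one_mul]; exact O.pow_mem hE _
  · simp [O.zero_mem]

lemma IntP.pow {O E k G} (hG : IntP O E k G) (m : ℕ) : IntP O E k (G ^ m) := by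
  induction m with
  | zero =>
    rw [pow_zero, ← map_one (PowerSeries.C : ℂ →+* ℂ⟦X⟧)]; exact IntP.C O.one_mem
  | succ m ih => rw [pow_succ]; exact ih.mul hG

lemma int_node (O : Subring ℂ) (k m : ℕ) (n p q r : ℂ) (hn : n ∈ O) (hp : p ∈ O) (hq : q ∈ O)
    (hr : r ∈ O) (hpq : p ≠ q) (hpr : p ≠ r) :
    coeff k (gs k n * (C p + X) ^ m * ((nu p q)⁻¹ * (nu p r)⁻¹) ^ (k + 1)) *
      (4 ^ k * ((p - q) * (p - r)) ^ (2 * k + 1)) ∈ O := by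
  have hd1 : p - q ≠ 0 := sub_ne_zero.mpr hpq
  have hd2 : p - r ≠ 0 := sub_ne_zero.mpr hpr
  have o1 : p - q ∈ O := O.sub_mem hp hq
  have o2 : p - r ∈ O := O.sub_mem hp hr
  have h4 : (4 : ℂ) ∈ O := by
    have := natCast_mem O 4
    simpa using this
  set E : ℂ := 4 * ((p - q) * (p - r)) with hE
  have oE : E ∈ O := O.mul_mem h4 (O.mul_mem o1 o2)
  have i1 : IntP O E k (gs k n) := by
    intro l hl
    obtain ⟨z, hz⟩ := bc_int k l
    simp only [gs, coeff_mk]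
    have h6 : (k : ℤ) - l = ((k - l : ℕ) : ℤ) := by rw [Nat.cast_sub hl]
    rw [h6, zpow_natCast, hE, mul_pow]
    have : bc k l * n ^ (k - l) * (4 ^ l * ((p - q) * (p - r)) ^ l) =
      z * n ^ (k - l) * ((p - q) * (p - r)) ^ l := by rw [← hz]; ring
    rw [this]
    exact O.mul_mem (O.mul_mem (intCast_mem O z) (O.pow_mem hn _)) (O.pow_mem (O.mul_mem o1 o2) _)
  have i2 : IntP O E k ((C p + X) ^ m) := ((IntP.C hp).add (IntP.X oE)).pow m
  have i3 : IntP O E k (C (p - q) * (nu p q)⁻¹) := by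
    intro l hl
    rw [coeff_C_mul, nu_inv_coeff hpq, hE]
    have : (p - q) * ((-1) ^ l * (p - q)⁻¹ ^ (l + 1)) * (4 * ((p - q) * (p - r))) ^ l
      = (-1) ^ l * (4 * (p - r)) ^ l := by
        simp only [mul_pow, inv_pow, pow_succ]; field_simp
    rw [this]
    exact O.mul_mem (O.pow_mem (O.neg_mem O.one_mem) _) (O.pow_mem (O.mul_mem h4 o2) _)
  have i4 : IntP O E k (C (p - r) * (nu p r)⁻¹) := by
    intro l hl
    rw [coeff_C_mul, nu_inv_coeff hpr, hE]
    have : (p - r) * ((-1) ^ l * (p - r)⁻¹ ^ (l + 1)) * (4 * ((p - q) * (p - r))) ^ l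
      = (-1) ^ l * (4 * (p - q)) ^ l := by
        simp only [mul_pow, inv_pow, pow_succ]; field_simp
    rw [this]
    exact O.mul_mem (O.pow_mem (O.neg_mem O.one_mem) _) (O.pow_mem (O.mul_mem h4 o1) _)
  have := ((i1.mul i2).mul ((i3.mul i4).pow (k + 1))) k le_rfl
  have e : gs k n * (C p + X) ^ m * (C (p - q) * (nu p q)⁻¹ * (C (p - r) * (nu p r)⁻¹)) ^ (k + 1)
    = C (((p - q) * (p - r)) ^ (k + 1)) *
      (gs k n * (C p + X) ^ m * ((nu p q)⁻¹ * (nu p r)⁻¹) ^ (k + 1)) := by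
    simp only [map_mul, map_pow, mul_pow]; ring
  rw [e, coeff_C_mul, hE] at this
  convert this using 1
  generalize coeff k (gs k n * (C p + X) ^ m * ((nu p q)⁻¹ * (nu p r)⁻¹) ^ (k + 1)) = w
  generalize (p - q) * (p - r) = d
  rw [mul_pow, show 2 * k + 1 = (k + 1) + k by ring, pow_add d (k + 1) k]
  ring

/-- nodes `0, -b, -a` -/
def nodes (a b : ℂ) : Fin 3 → ℂ := ![0, -b, -a]

lemma nodes_inj {a b : ℂ} (ha : a ≠ 0) (hb : b ≠ 0) (hab : a ≠ b) :
    Function.Injective (nodes a b) := by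
  intro i j h
  fin_cases i <;> fin_cases j <;> simp_all [nodes]

lemma int_pj (O : Subring ℂ) (a b N : ℂ) (ha : a ∈ O) (hb : b ∈ O) (hN : N ∈ O)
    (ha0 : a ≠ 0) (hb0 : b ≠ 0) (hab : a ≠ b) (k m : ℕ) (j : Fin 3) :
    pj (nodes a b) N k j m * (4 ^ k * (a * b * (a - b)) ^ (2 * k + 1)) ∈ O := by
  have oa : -a ∈ O := O.neg_mem ha
  have ob : -b ∈ O := O.neg_mem hb
  have h01 : nodes a b 0 ≠ nodes a b 1 := fun e => by simpa using nodes_inj ha0 hb0 hab e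
  have h02 : nodes a b 0 ≠ nodes a b 2 := fun e => by simpa using nodes_inj ha0 hb0 hab e
  have h12 : nodes a b 1 ≠ nodes a b 2 := fun e => by simpa using nodes_inj ha0 hb0 hab e
  have m0 : nodes a b 0 ∈ O := O.zero_mem
  have m1 : nodes a b 1 ∈ O := ob
  have m2 : nodes a b 2 ∈ O := oa
  have fin : ∀ w d d' : ℂ, d' ∈ O → w * (4 ^ k * d ^ (2 * k + 1)) ∈ O →
      a * b * (a - b) = d * d' → w * (4 ^ k * (a * b * (a - b)) ^ (2 * k + 1)) ∈ O := by
    intro w d d' h1 h2 h3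
    rw [h3, mul_pow, ← mul_assoc, ← mul_assoc]
    rw [← mul_assoc] at h2
    exact O.mul_mem h2 (O.pow_mem h1 _)
  unfold pj
  fin_cases j
  · have := int_node O k m (N + nodes a b 0) _ _ _ (O.add_mem hN m0) m0 m1 m2 h01 h02
    simp only [Fin.zero_eta, Vp_zero]
    refine fin _ _ (a - b) (O.sub_mem ha hb) this ?_
    simp only [nodes, Matrix.cons_val]; ring
  · have := int_node O k m (N + nodes a b 1) _ _ _ (O.add_mem hN m1) m1 m0 m2 h01.symm h12
    simp only [Fin.mk_one, Vp_one]
    refine fin _ _ (-a) oa this ?_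
    simp only [nodes, Matrix.cons_val]; ring
  · have := int_node O k m (N + nodes a b 2) _ _ _ (O.add_mem hN m2) m2 m0 m1 h02.symm h12.symm
    simp only [Fin.reduceFinMk, Vp_two]
    refine fin _ _ b hb this ?_
    simp only [nodes, Matrix.cons_val]; ring

end DTup

namespace DTup
open PowerSeries

/-- truncated weighted norm -/
noncomputable def tn (k : ℕ) (G : ℂ⟦X⟧) : ℝ :=
  ∑ l ∈ Finset.range (k + 1), ‖coeff l G‖ * (1 / 2) ^ l

lemma tn_nonneg (k G) : 0 ≤ tn k G := Finset.sum_nonneg fun _ _ => by positivity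

lemma tn_mul (k : ℕ) (G H : ℂ⟦X⟧) : tn k (G * H) ≤ tn k G * tn k H := by
  unfold tn
  rw [Finset.sum_mul_sum, ← Finset.sum_product']
  have h1 : ∀ l ∈ Finset.range (k + 1), ‖coeff l (G * H)‖ * (1 / 2) ^ l ≤
      ∑ p ∈ Finset.HasAntidiagonal.antidiagonal l, (‖coeff p.1 G‖ * (1 / 2) ^ p.1) * (‖coeff p.2 H‖ * (1 / 2) ^ p.2) := by
    intro l _
    rw [coeff_mul]
    calc _ ≤ (∑ p ∈ Finset.HasAntidiagonal.antidiagonal l, ‖coeff p.1 G * coeff p.2 H‖) * (1 / 2 : ℝ) ^ l := by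
          gcongr; exact norm_sum_le _ _
      _ = _ := by
        rw [Finset.sum_mul]
        refine Finset.sum_congr rfl fun p hp => ?_
        have hp' := Finset.HasAntidiagonal.mem_antidiagonal.mp hp
        rw [← hp', pow_add, norm_mul]; ring
  refine (Finset.sum_le_sum h1).trans ?_
  rw [← Finset.sum_biUnion]
  · refine Finset.sum_le_sum_of_subset_of_nonneg ?_ fun _ _ _ => by positivity
    intro p hp
    simp only [Finset.mem_biUnion, Finset.mem_range, Finset.HasAntidiagonal.mem_antidiagonal] at hp
    obtain ⟨l, hl, hp⟩ := hp
    simp only [Finset.mem_product, Finset.mem_range]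
    omega
  · intro l _ l' _ hne
    rw [Function.onFun, Finset.disjoint_left]
    intro p hp hp'
    rw [Finset.HasAntidiagonal.mem_antidiagonal] at hp hp'
    exact hne (hp.symm.trans hp')

lemma tn_one (k : ℕ) : tn k 1 = 1 := by
  unfold tn
  rw [Finset.sum_eq_single 0]
  · simp
  · intro l _ hl; simp [coeff_one, hl]
  · simp

lemma tn_pow (k : ℕ) (G : ℂ⟦X⟧) (m : ℕ) : tn k (G ^ m) ≤ tn k G ^ m := by
  induction m with
  | zero => simp [tn_one]
  | succ m ih =>
    rw [pow_succ, pow_succ]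
    refine (tn_mul _ _ _).trans ?_
    exact mul_le_mul_of_nonneg_right ih (tn_nonneg _ _)

lemma coeff_le_tn (k : ℕ) (G : ℂ⟦X⟧) : ‖coeff k G‖ ≤ 2 ^ k * tn k G := by
  have h : ‖coeff k G‖ * (1 / 2) ^ k ≤ tn k G :=
    Finset.single_le_sum (f := fun l => ‖coeff l G‖ * (1 / 2 : ℝ) ^ l) (fun _ _ => by positivity)
      (Finset.mem_range.mpr (Nat.lt_succ_self k))
  calc ‖coeff k G‖ = 2 ^ k * (‖coeff k G‖ * (1 / 2) ^ k) := by
        rw [one_div, inv_pow]; field_simp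
    _ ≤ _ := by gcongr

lemma tn_nu_inv (k : ℕ) {p q : ℂ} (h : 1 ≤ ‖p - q‖) : tn k (nu p q)⁻¹ ≤ 2 := by
  have hpq : p ≠ q := by
    rintro rfl; simp at h; linarith
  have : ∀ l ∈ Finset.range (k + 1), ‖coeff l (nu p q)⁻¹‖ * (1 / 2 : ℝ) ^ l ≤ (1 / 2 : ℝ) ^ l := by
    intro l _
    rw [nu_inv_coeff hpq, norm_mul, norm_pow, norm_pow, norm_inv]
    have : ‖p - q‖⁻¹ ^ (l + 1) ≤ 1 := pow_le_one₀ (by positivity) (inv_le_one_of_one_le₀ h)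
    simp only [norm_neg, norm_one, one_pow, one_mul]
    exact mul_le_of_le_one_left (by positivity) this
  refine (Finset.sum_le_sum this).trans ?_
  have h2 := Summable.sum_le_tsum (f := fun l : ℕ => (1 / 2 : ℝ) ^ l) (Finset.range (k + 1))
    (fun _ _ => by positivity) summable_geometric_two
  rw [tsum_geometric_two] at h2
  exact h2

lemma tn_gs (k : ℕ) {n : ℂ} (hn : 1 ≤ ‖n‖) : tn k (gs k n) ≤ ‖n‖ ^ k * (3 / 2) ^ (k + 1) := by
  have hb : (3 / 2 : ℝ) ^ (k + 1) = ∑ l ∈ Finset.range (k + 2), (1 / 2) ^ l * ((k + 1).choose l : ℝ) := by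
    rw [show (3 / 2 : ℝ) = 1 / 2 + 1 by norm_num, add_pow]
    simp
  rw [hb, Finset.sum_range_succ, mul_add]
  have : tn k (gs k n) ≤ ‖n‖ ^ k * ∑ l ∈ Finset.range (k + 1), (1 / 2 : ℝ) ^ l * ((k + 1).choose l : ℝ) := by
    unfold tn
    rw [Finset.mul_sum]
    refine Finset.sum_le_sum fun l hl => ?_
    have hl' : l ≤ k := by simpa [Nat.lt_succ_iff] using hl
    have h6 : (k : ℤ) - l = ((k - l : ℕ) : ℤ) := by rw [Nat.cast_sub hl']
    simp only [gs, coeff_mk]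
    rw [h6, zpow_natCast, norm_mul, norm_pow]
    have h1 := bc_norm_le (k := k) (l := l) (by omega)
    have h2 : ‖n‖ ^ (k - l) ≤ ‖n‖ ^ k := pow_le_pow_right₀ hn (by omega)
    calc _ ≤ ((k + 1).choose l : ℝ) * ‖n‖ ^ k * (1 / 2) ^ l := by gcongr
      _ = _ := by ring
  have h3 : 0 ≤ ‖n‖ ^ k * ((1 / 2 : ℝ) ^ (k + 1) * ((k + 1).choose (k + 1) : ℝ)) := by positivity
  linarith

lemma tn_lin (k : ℕ) (p : ℂ) : tn k (C p + X) ≤ ‖p‖ + 1 := by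
  unfold tn
  cases k with
  | zero => simp
  | succ k =>
    rw [Finset.sum_range_succ', Finset.sum_range_succ', Finset.sum_eq_zero]
    · simp; norm_num; linarith
    · intro l _
      simp [coeff_X]

lemma size_node (k m : ℕ) (hm : m ≤ 2) (n p q r : ℂ) (B M : ℝ) (hn : 1 ≤ ‖n‖) (hnM : ‖n‖ ≤ M)
    (hp : ‖p‖ ≤ B) (hpq : 1 ≤ ‖p - q‖) (hpr : 1 ≤ ‖p - r‖) :
    ‖coeff k (gs k n * (C p + X) ^ m * ((nu p q)⁻¹ * (nu p r)⁻¹) ^ (k + 1))‖ ≤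
      6 * 12 ^ k * (B + 1) ^ 2 * M ^ k := by
  have hB : 0 ≤ B := (norm_nonneg p).trans hp
  have t1 : tn k ((C p + X) ^ m) ≤ (B + 1) ^ 2 := by
    calc _ ≤ tn k (C p + X) ^ m := tn_pow _ _ _
      _ ≤ (B + 1) ^ m := by
        apply pow_le_pow_left₀ (tn_nonneg _ _)
        linarith [tn_lin k p]
      _ ≤ _ := pow_le_pow_right₀ (by linarith) hm
  have t2 : tn k (((nu p q)⁻¹ * (nu p r)⁻¹) ^ (k + 1)) ≤ 4 ^ (k + 1) := by
    refine (tn_pow _ _ _).trans (pow_le_pow_left₀ (tn_nonneg _ _) ?_ _)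
    calc _ ≤ _ := tn_mul _ _ _
      _ ≤ 2 * 2 := mul_le_mul (tn_nu_inv k hpq) (tn_nu_inv k hpr) (tn_nonneg _ _) (by norm_num)
      _ = 4 := by norm_num
  calc _ ≤ 2 ^ k * _ := coeff_le_tn _ _
    _ ≤ 2 ^ k * ((tn k (gs k n) * tn k ((C p + X) ^ m)) * tn k (((nu p q)⁻¹ * (nu p r)⁻¹) ^ (k + 1))) := by
      gcongr
      refine (tn_mul _ _ _).trans ?_
      gcongr
      · exact tn_nonneg _ _
      · exact tn_mul _ _ _
    _ ≤ 2 ^ k * ((M ^ k * (3 / 2) ^ (k + 1) * (B + 1) ^ 2) * 4 ^ (k + 1)) := by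
      have hM : 0 ≤ M := by linarith
      have hg : tn k (gs k n) ≤ M ^ k * (3 / 2) ^ (k + 1) := (tn_gs k hn).trans (by gcongr)
      have := tn_nonneg k (gs k n)
      have := tn_nonneg k ((C p + X) ^ m)
      have := tn_nonneg k (((nu p q)⁻¹ * (nu p r)⁻¹) ^ (k + 1))
      gcongr
    _ = _ := by
      rw [show (12 : ℝ) = 2 * (3 / 2) * 4 by norm_num, mul_pow, mul_pow]
      ring

lemma smallness (α : Fin 3 → ℂ) (hα : Function.Injective α) (N : ℂ) (B : ℝ) (hB : 1 ≤ B)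
    (hαB : ∀ j, ‖α j‖ ≤ B) (hN : 4 * B ≤ ‖N‖) (k m : ℕ) (hk : 1 ≤ k) (hm : m ≤ 2) :
    ‖∑ j, (1 + α j / N) ^ (1 / 2 : ℂ) * pj α N k j m‖ ≤ 8 * 8 ^ k / ‖N‖ ^ (2 * k) := by
  have hN1 : 1 ≤ ‖N‖ := by linarith
  have hN0 : N ≠ 0 := by rintro rfl; simp at hN1; linarith
  have hs := form_hasSum α N (fun j => by linarith [hαB j]) k m
  set f : ℕ → ℂ := fun h => bc k h * N ^ ((k : ℤ) - h) * Dd α (fun _ => k + 1) (h + m) with hf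
  have hz : ∑ i ∈ Finset.range (3 * k + 2 - m), f i = 0 := by
    refine Finset.sum_eq_zero fun i hi => ?_
    have hi' := Finset.mem_range.mp hi
    simp only [hf]
    rw [Dd_vanish hα, mul_zero]
    simp; omega
  have hs' := (hasSum_nat_add_iff' (3 * k + 2 - m)).mpr hs
  rw [hz, sub_zero] at hs'
  rw [← hs'.tsum_eq]
  have hg := hasSum_geometric_two.mul_left (4 * 8 ^ k / ‖N‖ ^ (2 * k))
  have e : 8 * 8 ^ k / ‖N‖ ^ (2 * k) = 4 * 8 ^ k / ‖N‖ ^ (2 * k) * 2 := by ring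
  rw [e]
  refine tsum_of_norm_bounded hg fun i => ?_
  simp only [hf]
  set h := i + (3 * k + 2 - m) with hh
  have hhm : h + m = 3 * k + 2 + i := by omega
  have b1 : ‖bc k h‖ ≤ 1 := bc_norm_le_one k h (by omega)
  have b2 : ‖N ^ ((k : ℤ) - h)‖ ≤ 1 / (‖N‖ ^ (2 * k) * ‖N‖ ^ i) := by
    have : (k : ℤ) - h = -((h - k : ℕ) : ℤ) := by omega
    rw [this, zpow_neg, zpow_natCast, norm_inv, norm_pow, ← pow_add, ← one_div]
    apply one_div_le_one_div_of_le (by positivity)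
    exact pow_le_pow_right₀ hN1 (by omega)
  have b3 : ‖Dd α (fun _ => k + 1) (h + m)‖ ≤ 2 ^ (3 * k + 2 + i) * B ^ i := by
    have := Dd_bound hα hB hαB (h + m) (fun _ => k + 1)
    rw [hhm] at this ⊢
    have e2 : ∑ _j : Fin 3, (k + 1) = 3 * k + 3 := by simp; ring
    rw [e2] at this
    have e3 : B * (2 * B) ^ (3 * k + 2 + i) = 2 ^ (3 * k + 2 + i) * B ^ i * B ^ (3 * k + 3) := by
      rw [mul_pow]; ring
    rw [e3] at this
    exact le_of_mul_le_mul_right this (by positivity)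
  rw [norm_mul, norm_mul]
  calc _ ≤ 1 * (1 / (‖N‖ ^ (2 * k) * ‖N‖ ^ i)) * (2 ^ (3 * k + 2 + i) * B ^ i) := by gcongr
    _ = 4 * 8 ^ k / ‖N‖ ^ (2 * k) * (2 * B / ‖N‖) ^ i := by
      rw [div_pow, mul_pow, show (8 : ℝ) = 2 ^ 3 by norm_num, ← pow_mul]
      field_simp
      ring
    _ ≤ _ := by
      have : 2 * B / ‖N‖ ≤ 1 / 2 := by
        rw [div_le_div_iff₀ (by positivity) (by norm_num)]
        linarith
      exact mul_le_mul_of_nonneg_left (pow_le_pow_left₀ (by positivity) this _) (by positivity)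

end DTup

namespace DTup

lemma numeric (B C D v : ℝ) (hB : 18 ≤ B) (hC : B ^ 34 ≤ C) (hD : C ^ 21 ≤ D) (hv : 1 ≤ v)
    (hv2 : v ^ 2 ≤ 2 * B ^ 4 * C * D)
    (h : ∀ k : ℕ, 1 ≤ k → 1 ≤ v * (16 * B ^ 3 / (C ^ 2 / (128 * B ^ 6)) ^ k
      + 1536 * B ^ 5 * (384 * B ^ 8 * C) ^ k / D)) : False := by
  have hB0 : 0 < B := by linarith
  have hB1 : 1 ≤ B := by linarith
  have hC0 : 0 < C := lt_of_lt_of_le (by positivity) hC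
  have hC1 : 1 ≤ C := le_trans (one_le_pow₀ hB1) hC
  have hD0 : 0 < D := lt_of_lt_of_le (by positivity) hD
  have hC2 : B ^ 68 ≤ C ^ 2 := by
    calc B ^ 68 = (B ^ 34) ^ 2 := by ring
      _ ≤ C ^ 2 := by gcongr
  set X := C ^ 2 / (128 * B ^ 6) with hX
  set Y := 384 * B ^ 8 * C with hY
  have hY0 : 0 < Y := by positivity
  have hX0 : 0 < X := by positivity
  have p62 : (128 : ℝ) < B ^ 62 := by
    calc (128 : ℝ) < 18 ^ 62 := by norm_num
      _ ≤ B ^ 62 := by gcongr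
  have hX1 : 1 < X := by
    rw [hX, lt_div_iff₀ (by positivity), one_mul]
    calc 128 * B ^ 6 < B ^ 62 * B ^ 6 := by gcongr
      _ = B ^ 68 := by ring
      _ ≤ _ := hC2
  have p18 : (384 : ℝ) ^ 4 * 128 ^ 3 ≤ B ^ 18 := by
    calc (384 : ℝ) ^ 4 * 128 ^ 3 ≤ 18 ^ 18 := by norm_num
      _ ≤ B ^ 18 := by gcongr
  have hYX : Y ^ 4 ≤ X ^ 3 := by
    rw [hX, hY, div_pow, le_div_iff₀ (by positivity)]
    calc (384 * B ^ 8 * C) ^ 4 * (128 * B ^ 6) ^ 3 = (384 ^ 4 * 128 ^ 3) * B ^ 50 * C ^ 4 := by ring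
      _ ≤ B ^ 18 * B ^ 50 * C ^ 4 := by gcongr
      _ = B ^ 68 * C ^ 4 := by ring
      _ ≤ C ^ 2 * C ^ 4 := by gcongr
      _ = _ := by ring
  set V := 32 * B ^ 3 * v with hV
  have hV1 : 1 ≤ V := by
    have : 1 ≤ B ^ 3 := one_le_pow₀ hB1
    nlinarith
  obtain ⟨n, hn1, hn2⟩ := exists_nat_pow_near hV1 hX1
  have hk := h (n + 1) (by omega)
  have hXk : 0 < X ^ (n + 1) := by positivity
  have h1 : v * (16 * B ^ 3 / X ^ (n + 1)) ≤ 1 / 2 := by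
    rw [← mul_div_assoc, div_le_iff₀ hXk]
    linarith
  have h2 : D ≤ 3072 * B ^ 5 * v * Y ^ (n + 1) := by
    have : 1 / 2 ≤ v * (1536 * B ^ 5 * Y ^ (n + 1) / D) := by rw [mul_add] at hk; linarith
    rw [← mul_div_assoc, le_div_iff₀ hD0] at this
    linarith
  have h3 : (Y ^ n) ^ 4 ≤ V ^ 3 := by
    calc (Y ^ n) ^ 4 = (Y ^ 4) ^ n := by rw [← pow_mul, ← pow_mul, mul_comm]
      _ ≤ (X ^ 3) ^ n := by gcongr
      _ = (X ^ n) ^ 3 := by rw [← pow_mul, ← pow_mul, mul_comm]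
      _ ≤ V ^ 3 := by gcongr
  have h4 : D ^ 4 ≤ (3072 * B ^ 5 * v * Y) ^ 4 * V ^ 3 := by
    calc D ^ 4 ≤ (3072 * B ^ 5 * v * Y ^ (n + 1)) ^ 4 := by gcongr
      _ = (3072 * B ^ 5 * v * Y) ^ 4 * (Y ^ n) ^ 4 := by rw [pow_succ]; ring
      _ ≤ _ := by gcongr
  have h5 : D ^ 8 ≤ (3072 * 384) ^ 8 * 32 ^ 6 * B ^ 122 * C ^ 8 * (v ^ 2) ^ 7 := by
    calc D ^ 8 = (D ^ 4) ^ 2 := by ring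
      _ ≤ ((3072 * B ^ 5 * v * Y) ^ 4 * V ^ 3) ^ 2 := by gcongr
      _ = _ := by rw [hY, hV]; ring
  have p48 : (3072 * 384 : ℝ) ^ 8 * 32 ^ 6 * 2 ^ 7 ≤ B ^ 48 := by
    calc (3072 * 384 : ℝ) ^ 8 * 32 ^ 6 * 2 ^ 7 ≤ 18 ^ 48 := by norm_num
      _ ≤ B ^ 48 := by gcongr
  have h6 : D ^ 8 ≤ B ^ 198 * C ^ 15 * D ^ 7 := by
    calc D ^ 8 ≤ _ := h5
      _ ≤ (3072 * 384) ^ 8 * 32 ^ 6 * B ^ 122 * C ^ 8 * (2 * B ^ 4 * C * D) ^ 7 := by gcongr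
      _ = ((3072 * 384) ^ 8 * 32 ^ 6 * 2 ^ 7) * B ^ 150 * C ^ 15 * D ^ 7 := by ring
      _ ≤ B ^ 48 * B ^ 150 * C ^ 15 * D ^ 7 := by gcongr
      _ = _ := by ring
  have h7 : D ≤ B ^ 198 * C ^ 15 := by
    have : D * D ^ 7 ≤ B ^ 198 * C ^ 15 * D ^ 7 := by
      calc D * D ^ 7 = D ^ 8 := by ring
        _ ≤ _ := h6
    exact le_of_mul_le_mul_right this (by positivity)
  have h8 : B ^ 198 * C ^ 15 < C ^ 21 := by
    calc B ^ 198 * C ^ 15 < B ^ 204 * C ^ 15 := by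
          gcongr
          · linarith
          · norm_num
      _ = (B ^ 34) ^ 6 * C ^ 15 := by ring
      _ ≤ C ^ 6 * C ^ 15 := by gcongr
      _ = _ := by ring
  linarith

lemma half_re (w : ℂ) (hw : ‖w - 1‖ ≤ 1 / 2) :
    (w ^ (1 / 2 : ℂ)) ^ 2 = w ∧ 1 / 2 ≤ (w ^ (1 / 2 : ℂ)).re := by
  have hw0 : w ≠ 0 := by
    rintro rfl; norm_num at hw
  have hsq : (w ^ (1 / 2 : ℂ)) ^ 2 = w := by
    rw [← Complex.cpow_nat_mul]; norm_num
  refine ⟨hsq, ?_⟩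
  set θ := w ^ (1 / 2 : ℂ) with hθ
  have hre : 0 ≤ θ.re := by
    rw [hθ, Complex.cpow_def_of_ne_zero hw0, Complex.exp_re]
    apply mul_nonneg (Real.exp_pos _).le
    have : (Complex.log w * (1 / 2)).im = Complex.arg w / 2 := by
      have : (1 / 2 : ℂ) = ((1 / 2 : ℝ) : ℂ) := by norm_num
      rw [this, Complex.im_mul_ofReal, Complex.log_im]; ring
    rw [this]
    apply Real.cos_nonneg_of_neg_pi_div_two_le_of_le
    · linarith [Complex.neg_pi_lt_arg w]
    · linarith [Complex.arg_le_pi w]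
  have h1 : ‖θ - 1‖ * ‖θ + 1‖ ≤ 1 / 2 := by
    rw [← norm_mul]
    have : (θ - 1) * (θ + 1) = w - 1 := by rw [← hsq]; ring
    rw [this]; exact hw
  have h2 : 1 ≤ ‖θ + 1‖ := by
    have := Complex.re_le_norm (θ + 1)
    simp at this; linarith
  have h3 : ‖θ - 1‖ ≤ 1 / 2 := by nlinarith [norm_nonneg (θ - 1)]
  have h4 := Complex.abs_re_le_norm (θ - 1)
  have h5 := neg_abs_le (θ - 1).re
  simp at h4 h5
  linarith

/-- closeness of the algebraic approximations -/
lemma xi_close (a c d s x z θ : ℂ) (hs : s ^ 2 = a * c - 1) (hx : x ^ 2 = a * d - 1)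
    (hz : z ^ 2 = c * d - 1) (ha : 1 ≤ ‖a‖) (hac : ‖a‖ ≤ ‖c‖) (hc : 2 ≤ ‖c‖) (hd : 1 ≤ ‖d‖)
    (hθ : θ ^ 2 = 1 - 1 / (a * c)) (hre : 1 / 2 ≤ θ.re) (hxi : 0 ≤ (s * x / (a * z)).re) :
    ‖s * x / (a * z) - θ‖ ≤ 16 / ‖d‖ := by
  have ha0 : a ≠ 0 := by rintro rfl; norm_num at ha
  have hc0 : c ≠ 0 := by rintro rfl; norm_num at hc
  have hd0 : d ≠ 0 := by rintro rfl; norm_num at hd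
  have hcd : ‖c‖ * ‖d‖ / 2 ≤ ‖c * d - 1‖ := by
    have h1 : ‖c * d‖ - ‖(1 : ℂ)‖ ≤ ‖c * d - 1‖ := norm_sub_norm_le _ _
    rw [norm_mul, norm_one] at h1
    nlinarith
  have hcdpos : 0 < ‖c * d - 1‖ := by
    have : 0 < ‖c‖ * ‖d‖ / 2 := by positivity
    linarith
  have hz0 : c * d - 1 ≠ 0 := norm_pos_iff.mp hcdpos
  have hzne : z ≠ 0 := by rintro rfl; apply hz0; rw [← hz]; ring
  set ξ := s * x / (a * z) with hξ
  have e : (ξ - θ) * (ξ + θ) = (1 - 1 / (a * c)) * (a - c) / (a * (c * d - 1)) := by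
    have : ξ ^ 2 = (a * c - 1) * (a * d - 1) / (a ^ 2 * (c * d - 1)) := by
      rw [hξ, div_pow, mul_pow, mul_pow, hs, hx, hz]
    calc (ξ - θ) * (ξ + θ) = ξ ^ 2 - θ ^ 2 := by ring
      _ = _ := by rw [this, hθ]; field_simp; ring
  have hn1 : ‖1 - 1 / (a * c)‖ ≤ 2 := by
    calc ‖1 - 1 / (a * c)‖ ≤ ‖(1 : ℂ)‖ + ‖1 / (a * c)‖ := norm_sub_le _ _
      _ ≤ 1 + 1 := by
        rw [norm_one, norm_div, norm_one, norm_mul]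
        gcongr
        rw [div_le_one (by positivity)]
        nlinarith
      _ = 2 := by norm_num
  have hn2 : ‖a - c‖ ≤ 2 * ‖c‖ := by linarith [norm_sub_le a c]
  have hb : ‖ξ - θ‖ * ‖ξ + θ‖ ≤ 8 / ‖d‖ := by
    rw [← norm_mul, e, norm_div, norm_mul, norm_mul]
    rw [div_le_div_iff₀ (by positivity) (by positivity)]
    have h1 : ‖1 - 1 / (a * c)‖ * ‖a - c‖ ≤ 2 * (2 * ‖c‖) := by gcongr
    have h2 : ‖c‖ * ‖d‖ / 2 ≤ ‖a‖ * ‖c * d - 1‖ := by nlinarith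
    calc _ ≤ 2 * (2 * ‖c‖) * ‖d‖ := by gcongr
      _ = 8 * (‖c‖ * ‖d‖ / 2) := by ring
      _ ≤ _ := by gcongr
  have hl : 1 / 2 ≤ ‖ξ + θ‖ := by
    have := Complex.re_le_norm (ξ + θ)
    rw [Complex.add_re] at this; linarith
  have : ‖ξ - θ‖ * (1 / 2) ≤ 8 / ‖d‖ := le_trans (by gcongr) hb
  have e2 : 16 / ‖d‖ = 2 * (8 / ‖d‖) := by ring
  linarith

end DTup

namespace DTup

lemma size_pj (O : Subring ℂ) (hO : ∀ z ∈ O, z ≠ 0 → 1 ≤ ‖z‖) (a b N : ℂ) (ha : a ∈ O) (hb : b ∈ O)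
    (hN : N ∈ O) (ha0 : a ≠ 0) (hb0 : b ≠ 0) (hab : a ≠ b) (k m : ℕ) (hm : m ≤ 2) (j : Fin 3)
    (B M : ℝ) (hnj : N + nodes a b j ≠ 0) (haB : ‖a‖ ≤ B) (hbB : ‖b‖ ≤ B) (hM : ‖N‖ + B ≤ M) :
    ‖pj (nodes a b) N k j m‖ ≤ 6 * 12 ^ k * (B + 1) ^ 2 * M ^ k := by
  have hinj := nodes_inj ha0 hb0 hab
  have mem : ∀ j, nodes a b j ∈ O := by
    intro j; fin_cases j
    · exact O.zero_mem
    · exact O.neg_mem hb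
    · exact O.neg_mem ha
  have hB : ∀ j, ‖nodes a b j‖ ≤ B := by
    intro j; fin_cases j
    · simpa [nodes] using (norm_nonneg a).trans haB
    · simpa [nodes] using hbB
    · simpa [nodes] using haB
  have hd : ∀ i j, i ≠ j → 1 ≤ ‖nodes a b i - nodes a b j‖ := fun i j hij =>
    hO _ (O.sub_mem (mem i) (mem j)) (sub_ne_zero.mpr fun e => hij (hinj e))
  have hn1 : 1 ≤ ‖N + nodes a b j‖ := hO _ (O.add_mem hN (mem j)) hnj
  have hn2 : ‖N + nodes a b j‖ ≤ M := by linarith [norm_add_le N (nodes a b j), hB j]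
  unfold pj
  fin_cases j
  · simp only [Fin.zero_eta, Vp_zero]
    exact size_node k m hm _ _ _ _ B M hn1 hn2 (hB 0) (hd _ _ (by decide)) (hd _ _ (by decide))
  · simp only [Fin.mk_one, Vp_one]
    exact size_node k m hm _ _ _ _ B M hn1 hn2 (hB 1) (hd _ _ (by decide)) (hd _ _ (by decide))
  · simp only [Fin.reduceFinMk, Vp_two]
    exact size_node k m hm _ _ _ _ B M hn1 hn2 (hB 2) (hd _ _ (by decide)) (hd _ _ (by decide))

lemma choose_sign (O : Subring ℂ) (x r : ℂ) (hx : x ∈ O) (hr : x ^ 2 = r) (s w : ℂ) :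
    ∃ x' ∈ O, x' ^ 2 = r ∧ 0 ≤ (s * x' / w).re := by
  rcases le_total 0 (s * x / w).re with h | h
  · exact ⟨x, hx, hr, h⟩
  · refine ⟨-x, O.neg_mem hx, by rw [neg_sq, hr], ?_⟩
    have : s * -x / w = -(s * x / w) := by ring
    rw [this, Complex.neg_re]; linarith

set_option maxHeartbeats 1000000 in
theorem rickert (O : Subring ℂ) (hO : ∀ z ∈ O, z ≠ 0 → 1 ≤ ‖z‖)
    (a b c d s t x y z : ℂ) (ha : a ∈ O) (hb : b ∈ O) (hc : c ∈ O) (hd : d ∈ O)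
    (hs : s ∈ O) (ht : t ∈ O) (hx : x ∈ O) (hy : y ∈ O) (hz : z ∈ O)
    (ha0 : a ≠ 0) (hab : a ≠ b)
    (es : s ^ 2 = a * c - 1) (et : t ^ 2 = b * c - 1) (ex : x ^ 2 = a * d - 1)
    (ey : y ^ 2 = b * d - 1) (ez : z ^ 2 = c * d - 1)
    (hB : 18 ≤ ‖b‖) (haB : ‖a‖ ≤ ‖b‖) (hC : ‖b‖ ^ 34 ≤ ‖c‖) (hD : ‖c‖ ^ 21 ≤ ‖d‖) : False := by
  obtain ⟨x, hx, ex, rx⟩ := choose_sign O x _ hx ex s (a * z)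
  obtain ⟨y, hy, ey, ry⟩ := choose_sign O y _ hy ey t (b * z)
  have hb0 : b ≠ 0 := by rintro rfl; norm_num at hB
  have ha1 : 1 ≤ ‖a‖ := hO a ha ha0
  have hb1 : 1 ≤ ‖b‖ := by linarith
  have hbc : ‖b‖ ≤ ‖c‖ := le_trans (le_self_pow₀ hb1 (by norm_num)) hC
  have hbc2 : 4 * ‖b‖ ≤ ‖c‖ := by
    calc 4 * ‖b‖ ≤ ‖b‖ * ‖b‖ := by nlinarith
      _ = ‖b‖ ^ 2 := by ring
      _ ≤ ‖b‖ ^ 34 := pow_le_pow_right₀ hb1 (by norm_num)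
      _ ≤ _ := hC
  have hc1 : 1 ≤ ‖c‖ := by linarith
  have hc0 : c ≠ 0 := by rintro rfl; norm_num at hc1
  have hcd : ‖c‖ ≤ ‖d‖ := le_trans (le_self_pow₀ hc1 (by norm_num)) hD
  have hd1 : 1 ≤ ‖d‖ := by linarith
  set N := a * b * c with hNdef
  have hN : N ∈ O := O.mul_mem (O.mul_mem ha hb) hc
  have hN0 : N ≠ 0 := mul_ne_zero (mul_ne_zero ha0 hb0) hc0
  have hNn : ‖N‖ = ‖a‖ * ‖b‖ * ‖c‖ := by rw [hNdef, norm_mul, norm_mul]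
  have hab1 : 1 ≤ ‖a‖ * ‖b‖ := by nlinarith
  have hNC : ‖c‖ ≤ ‖N‖ := by rw [hNn]; nlinarith
  have hNle : ‖N‖ + ‖b‖ ≤ 2 * ‖b‖ ^ 2 * ‖c‖ := by
    have h1 : ‖a‖ * ‖b‖ * ‖c‖ ≤ ‖b‖ * ‖b‖ * ‖c‖ := by gcongr
    have h2 : ‖b‖ ≤ ‖b‖ * ‖b‖ * ‖c‖ := by nlinarith [mul_le_mul hb1 hc1 (by norm_num) (by positivity)]
    rw [hNn]; nlinarith
  have hinj := nodes_inj ha0 hb0 hab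
  have hαB : ∀ j, ‖nodes a b j‖ ≤ ‖b‖ := by
    intro j; fin_cases j
    · simp [nodes]
    · simp [nodes]
    · simpa [nodes] using haB
  have hnj : ∀ j, N + nodes a b j ≠ 0 := by
    intro j h0
    have : N = - nodes a b j := eq_neg_of_add_eq_zero_left h0
    have h2 := hαB j
    rw [← norm_neg, ← this] at h2
    linarith
  -- theta
  have w1 : 1 + nodes a b 1 / N = 1 - 1 / (a * c) := by
    simp only [nodes, Matrix.cons_val, hNdef]; field_simp; ring
  have w2 : 1 + nodes a b 2 / N = 1 - 1 / (b * c) := by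
    simp only [nodes, Matrix.cons_val, hNdef]; field_simp; ring
  have near : ∀ j, ‖1 + nodes a b j / N - 1‖ ≤ 1 / 2 := by
    intro j
    rw [add_sub_cancel_left, norm_div, div_le_div_iff₀ (by linarith) (by norm_num)]
    linarith [hαB j]
  set θ : Fin 3 → ℂ := fun j => (1 + nodes a b j / N) ^ (1 / 2 : ℂ) with hθ
  have θ0 : θ 0 = 1 := by simp [hθ, nodes]
  obtain ⟨q1, r1⟩ := half_re _ (near 1)
  obtain ⟨q2, r2⟩ := half_re _ (near 2)
  have close1 : ‖s * x / (a * z) - θ 1‖ ≤ 16 / ‖d‖ :=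
    xi_close a c d s x z (θ 1) es ex ez ha1 (by linarith) (by linarith) hd1
      (by rw [← w1]; exact q1) r1 rx
  have close2 : ‖t * y / (b * z) - θ 2‖ ≤ 16 / ‖d‖ :=
    xi_close b c d t y z (θ 2) et ey ez hb1 (by linarith) (by linarith) hd1
      (by rw [← w2]; exact q2) r2 ry
  have hz0 : z ≠ 0 := by
    rintro rfl
    have h1 : c * d = 1 := by linear_combination -ez
    have h2 := congrArg norm h1
    rw [norm_mul, norm_one] at h2
    nlinarith
  set v : Fin 3 → ℂ := ![a * b * z, s * b * x, t * a * y] with hv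
  have hv0 : v 0 = a * b * z := rfl
  have hv1 : v 1 = v 0 * (s * x / (a * z)) := by
    simp only [hv, Matrix.cons_val]; field_simp
  have hv2 : v 2 = v 0 * (t * y / (b * z)) := by
    simp only [hv, Matrix.cons_val]; field_simp
  have hvO : ∀ j, v j ∈ O := by
    intro j; fin_cases j
    · exact O.mul_mem (O.mul_mem ha hb) hz
    · exact O.mul_mem (O.mul_mem hs hb) hx
    · exact O.mul_mem (O.mul_mem ht ha) hy
  have hv00 : v 0 ≠ 0 := by rw [hv0]; exact mul_ne_zero (mul_ne_zero ha0 hb0) hz0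
  refine numeric ‖b‖ ‖c‖ ‖d‖ ‖v 0‖ hB hC hD (hO _ (hvO 0) hv00) ?_ ?_
  · have h1 : ‖z‖ ^ 2 ≤ 2 * ‖c‖ * ‖d‖ := by
      rw [← norm_pow, ez]
      have := norm_sub_le (c * d) 1
      rw [norm_mul, norm_one] at this
      nlinarith
    have h2 : ‖a‖ ^ 2 ≤ ‖b‖ ^ 2 := by gcongr
    calc ‖v 0‖ ^ 2 = ‖a‖ ^ 2 * ‖b‖ ^ 2 * ‖z‖ ^ 2 := by rw [hv0, norm_mul, norm_mul]; ring
      _ ≤ ‖b‖ ^ 2 * ‖b‖ ^ 2 * (2 * ‖c‖ * ‖d‖) := by gcongr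
      _ = _ := by ring
  · intro k hk
    obtain ⟨m, hm, hne⟩ : ∃ m ≤ 2, ∑ j, v j * pj (nodes a b) N k j m ≠ 0 := by
      by_contra hcon
      push Not at hcon
      exact hv00 (nonvanish _ hinj N hnj k v hcon 0)
    set T : ℂ := 4 ^ k * (a * b * (a - b)) ^ (2 * k + 1) with hT
    have hT0 : T ≠ 0 := by
      rw [hT]
      exact mul_ne_zero (pow_ne_zero _ (by norm_num)) (pow_ne_zero _ (mul_ne_zero (mul_ne_zero ha0 hb0) (sub_ne_zero.mpr hab)))
    set S := ∑ j, v j * pj (nodes a b) N k j m with hS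
    have hGO : S * T ∈ O := by
      rw [hS, Finset.sum_mul]
      refine O.sum_mem fun j _ => ?_
      rw [mul_assoc]
      exact O.mul_mem (hvO j) (int_pj O a b N ha hb hN ha0 hb0 hab k m j)
    have h1 : 1 ≤ ‖S * T‖ := hO _ hGO (mul_ne_zero hne hT0)
    set P : ℝ := 6 * 12 ^ k * (‖b‖ + 1) ^ 2 * (2 * ‖b‖ ^ 2 * ‖c‖) ^ k with hP
    have hpj : ∀ j, ‖pj (nodes a b) N k j m‖ ≤ P := fun j =>
      size_pj O hO a b N ha hb hN ha0 hb0 hab k m hm j ‖b‖ _ (hnj j) haB le_rfl hNle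
    have hsm := smallness (nodes a b) hinj N ‖b‖ hb1 hαB (by linarith) k m hk hm
    have hSe : S = v 0 * ((∑ j, θ j * pj (nodes a b) N k j m)
        + ((s * x / (a * z) - θ 1) * pj (nodes a b) N k 1 m
          + (t * y / (b * z) - θ 2) * pj (nodes a b) N k 2 m)) := by
      rw [hS, Fin.sum_univ_three, Fin.sum_univ_three, hv1, hv2, θ0]; ring
    have hSn : ‖S‖ ≤ ‖v 0‖ * (8 * 8 ^ k / ‖N‖ ^ (2 * k) + (16 / ‖d‖ * P + 16 / ‖d‖ * P)) := by
      rw [hSe, norm_mul]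
      gcongr
      refine (norm_add_le _ _).trans ?_
      refine add_le_add hsm ?_
      refine (norm_add_le _ _).trans ?_
      rw [norm_mul, norm_mul]
      have := hpj 1
      have := hpj 2
      gcongr
    have hTn : ‖T‖ ≤ 2 * ‖b‖ ^ 3 * (16 * ‖b‖ ^ 6) ^ k := by
      have hd' : ‖a - b‖ ≤ 2 * ‖b‖ := by linarith [norm_sub_le a b]
      have h4 : ‖(4 : ℂ)‖ = 4 := by norm_num
      rw [hT, norm_mul, norm_pow, norm_pow, norm_mul, norm_mul, h4]
      calc (4 : ℝ) ^ k * (‖a‖ * ‖b‖ * ‖a - b‖) ^ (2 * k + 1)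
          ≤ 4 ^ k * (‖b‖ * ‖b‖ * (2 * ‖b‖)) ^ (2 * k + 1) := by gcongr
        _ = 4 ^ k * ((2 * ‖b‖ ^ 3) ^ 2) ^ k * (2 * ‖b‖ ^ 3) := by
          rw [← pow_mul, pow_succ]; ring
        _ = (4 * (2 * ‖b‖ ^ 3) ^ 2) ^ k * (2 * ‖b‖ ^ 3) := by rw [mul_pow 4]
        _ = _ := by
          rw [show 4 * (2 * ‖b‖ ^ 3) ^ 2 = 16 * ‖b‖ ^ 6 by ring]; ring
    have hPle : P ≤ 24 * ‖b‖ ^ 2 * (24 * ‖b‖ ^ 2 * ‖c‖) ^ k := by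
      have : (‖b‖ + 1) ^ 2 ≤ 4 * ‖b‖ ^ 2 := by nlinarith
      calc P ≤ 6 * 12 ^ k * (4 * ‖b‖ ^ 2) * (2 * ‖b‖ ^ 2 * ‖c‖) ^ k := by rw [hP]; gcongr
        _ = 24 * ‖b‖ ^ 2 * (12 * (2 * ‖b‖ ^ 2 * ‖c‖)) ^ k := by rw [mul_pow 12]; ring
        _ = _ := by rw [show 12 * (2 * ‖b‖ ^ 2 * ‖c‖) = 24 * ‖b‖ ^ 2 * ‖c‖ by ring]
    have hNk : 8 * 8 ^ k / ‖N‖ ^ (2 * k) ≤ 8 * (8 / ‖c‖ ^ 2) ^ k := by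
      rw [div_pow, ← pow_mul, ← mul_div_assoc]
      gcongr
    calc 1 ≤ ‖S‖ * ‖T‖ := by rw [← norm_mul]; exact h1
      _ ≤ (‖v 0‖ * (8 * (8 / ‖c‖ ^ 2) ^ k + (16 / ‖d‖ * (24 * ‖b‖ ^ 2 * (24 * ‖b‖ ^ 2 * ‖c‖) ^ k) + 16 / ‖d‖ * (24 * ‖b‖ ^ 2 * (24 * ‖b‖ ^ 2 * ‖c‖) ^ k)))) *
            (2 * ‖b‖ ^ 3 * (16 * ‖b‖ ^ 6) ^ k) := by
          refine mul_le_mul (hSn.trans ?_) hTn (norm_nonneg _) (by positivity)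
          gcongr
      _ = ‖v 0‖ * (16 * ‖b‖ ^ 3 * ((8 / ‖c‖ ^ 2) * (16 * ‖b‖ ^ 6)) ^ k +
            1536 * ‖b‖ ^ 5 * ((24 * ‖b‖ ^ 2 * ‖c‖) * (16 * ‖b‖ ^ 6)) ^ k / ‖d‖) := by
          rw [mul_pow (8 / ‖c‖ ^ 2), mul_pow (24 * ‖b‖ ^ 2 * ‖c‖)]; ring
      _ = _ := by
          have e1 : (8 / ‖c‖ ^ 2) * (16 * ‖b‖ ^ 6) = (‖c‖ ^ 2 / (128 * ‖b‖ ^ 6))⁻¹ := by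
            rw [inv_div]; ring
          have e2 : (24 * ‖b‖ ^ 2 * ‖c‖) * (16 * ‖b‖ ^ 6) = 384 * ‖b‖ ^ 8 * ‖c‖ := by ring
          rw [e1, e2, inv_pow]; ring

end DTup

namespace DTup
open ComplexConjugate

/-- the ring of integers inside ℂ -/
def OK (K : Subfield ℂ) : Subring ℂ := K.toSubring ⊓ (integralClosure ℤ ℂ).toSubring

lemma mem_OK {K : Subfield ℂ} {z : ℂ} : z ∈ OK K ↔ z ∈ K ∧ IsIntegral ℤ z := Iff.rfl

lemma dep3 (K : Subfield ℂ) (hdeg : Module.finrank ℚ K = 2) (x : Fin 3 → ℂ) (hx : ∀ i, x i ∈ K) :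
    ∃ g : Fin 3 → ℚ, (g 0 : ℂ) * x 0 + g 1 * x 1 + g 2 * x 2 = 0 ∧ ∃ i, g i ≠ 0 := by
  have : Module.Finite ℚ K := Module.finite_of_finrank_pos (by omega)
  have h : ¬ LinearIndependent ℚ (fun i => (⟨x i, hx i⟩ : K)) := by
    intro h
    have := h.fintype_card_le_finrank
    rw [hdeg] at this; simp at this
  obtain ⟨g, hg, hi⟩ := Fintype.not_linearIndependent_iff.mp h
  refine ⟨g, ?_, hi⟩
  have := congrArg (fun z : K => (z : ℂ)) hg
  simp only [Fin.sum_univ_three] at this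
  simpa [Rat.smul_def] using this

lemma rat_parts (K : Subfield ℂ) (hdeg : Module.finrank ℚ K = 2) (w : ℂ) (hw : w ∈ K)
    (hwi : w.im ≠ 0) (z : ℂ) (hz : z ∈ K) :
    (∃ q : ℚ, z + conj z = q) ∧ ∃ q : ℚ, z * conj z = q := by
  by_cases hi : z.im = 0
  · obtain ⟨g, hg, i, hgi⟩ := dep3 K hdeg ![1, z, w] (by
      intro i; fin_cases i
      · exact K.one_mem
      · exact hz
      · exact hw)
    simp only [Matrix.cons_val] at hg
    have him := congrArg Complex.im hg
    have hre := congrArg Complex.re hg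
    simp [hi, hwi] at him hre
    rw [him] at hre
    have h1 : g 1 ≠ 0 := by
      intro h1
      rw [h1] at hre
      simp at hre
      fin_cases i <;> simp_all
    have hzr : z = ((-(g 0) / g 1 : ℚ) : ℂ) := by
      have hzz : z = (z.re : ℂ) := by apply Complex.ext <;> simp [hi]
      have h1' : (g 1 : ℝ) ≠ 0 := by exact_mod_cast h1
      have : z.re = -(g 0) / g 1 := by field_simp; simp at hre; linarith
      rw [hzz, this]; push_cast; rfl
    have hc : conj z = z := by rw [hzr]; simp
    rw [hc, hzr]
    exact ⟨⟨(-(g 0) / g 1) + (-(g 0) / g 1), by push_cast; rfl⟩, ⟨(-(g 0) / g 1) * (-(g 0) / g 1), by push_cast; rfl⟩⟩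
  · obtain ⟨g, hg, i, hgi⟩ := dep3 K hdeg ![1, z, z ^ 2] (by
      intro i; fin_cases i
      · exact K.one_mem
      · exact hz
      · exact K.pow_mem hz 2)
    simp only [Matrix.cons_val] at hg
    have hg' := congrArg conj hg
    simp at hg'
    have hne : z - conj z ≠ 0 := by
      intro h
      apply hi
      have := congrArg Complex.im h
      simp at this; linarith
    have e1 : (g 1 : ℂ) + g 2 * (z + conj z) = 0 := by
      have : (z - conj z) * ((g 1 : ℂ) + g 2 * (z + conj z)) = 0 := by linear_combination hg - hg'
      exact (mul_eq_zero.mp this).resolve_left hne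
    have e2 : (g 0 : ℂ) - g 2 * (z * conj z) = 0 := by
      linear_combination hg - z * e1
    have h2 : g 2 ≠ 0 := by
      intro h2
      rw [h2] at e1 e2
      simp at e1 e2
      fin_cases i <;> simp_all
    have h2' : (g 2 : ℂ) ≠ 0 := by exact_mod_cast h2
    refine ⟨⟨-(g 1) / g 2, ?_⟩, ⟨g 0 / g 2, ?_⟩⟩
    · push_cast; field_simp; linear_combination e1
    · push_cast; field_simp; linear_combination -e2

lemma int_of_rat (q : ℚ) (h : IsIntegral ℤ (q : ℂ)) : ∃ n : ℤ, (q : ℂ) = n := by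
  have h1 : IsIntegral ℤ q := by
    have : (q : ℂ) = algebraMap ℚ ℂ q := rfl
    rw [this] at h
    exact (isIntegral_algebraMap_iff (algebraMap ℚ ℂ).injective).mp h
  obtain ⟨n, hn⟩ := IsIntegrallyClosed.isIntegral_iff.mp h1
  refine ⟨n, ?_⟩
  rw [← hn]; simp

lemma conj_int {z : ℂ} (h : IsIntegral ℤ z) : IsIntegral ℤ (conj z) := by
  have := h.map ((Complex.conjAe : ℂ →ₐ[ℝ] ℂ).restrictScalars ℤ)
  exact this

structure IsQI (O : Subring ℂ) : Prop where
  tr : ∀ z ∈ O, ∃ t : ℤ, 2 * z.re = t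
  nm : ∀ z ∈ O, ∃ n : ℕ, ‖z‖ ^ 2 = n
  nr : ∃ z ∈ O, z.im ≠ 0

lemma OK_isQI (K : Subfield ℂ) (hdeg : Module.finrank ℚ K = 2) (w : ℂ) (hw : w ∈ K)
    (hwi : w.im ≠ 0) : IsQI (OK K) := by
  refine ⟨?_, ?_, ?_⟩
  · intro z hz
    obtain ⟨hzK, hzi⟩ := mem_OK.mp hz
    obtain ⟨q, hq⟩ := (rat_parts K hdeg w hw hwi z hzK).1
    have h1 : IsIntegral ℤ (q : ℂ) := by rw [← hq]; exact hzi.add (conj_int hzi)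
    obtain ⟨n, hn⟩ := int_of_rat q h1
    refine ⟨n, ?_⟩
    have := congrArg Complex.re (hq.trans hn)
    simp at this; linarith
  · intro z hz
    obtain ⟨hzK, hzi⟩ := mem_OK.mp hz
    obtain ⟨q, hq⟩ := (rat_parts K hdeg w hw hwi z hzK).2
    have h1 : IsIntegral ℤ (q : ℂ) := by rw [← hq]; exact hzi.mul (conj_int hzi)
    obtain ⟨n, hn⟩ := int_of_rat q h1
    have h2 : ‖z‖ ^ 2 = (n : ℝ) := by
      have := hq.trans hn
      rw [Complex.mul_conj, Complex.normSq_eq_norm_sq] at this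
      exact_mod_cast this
    have h3 : 0 ≤ n := by
      have : (0 : ℝ) ≤ n := by rw [← h2]; positivity
      exact_mod_cast this
    lift n to ℕ using h3
    exact ⟨n, by simpa using h2⟩
  · have : Module.Finite ℚ K := Module.finite_of_finrank_pos (by omega)
    have ha : IsAlgebraic ℚ (⟨w, hw⟩ : K) := Algebra.IsAlgebraic.isAlgebraic _
    have ha2 : IsAlgebraic ℚ w := by
      have hm := ha.algHom (K.subtype.toRatAlgHom)
      exact hm
    have ha3 : IsAlgebraic ℤ w := (IsFractionRing.isAlgebraic_iff ℤ ℚ ℂ).mpr ha2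
    obtain ⟨y, hy, hyi⟩ := ha3.exists_integral_multiple
    refine ⟨y • w, mem_OK.mpr ⟨?_, hyi⟩, ?_⟩
    · exact K.zsmul_mem hw y
    · simp [hy, hwi]

lemma IsQI.one_le {O : Subring ℂ} (h : IsQI O) (z : ℂ) (hz : z ∈ O) (h0 : z ≠ 0) : 1 ≤ ‖z‖ := by
  obtain ⟨n, hn⟩ := h.nm z hz
  have h1 : 0 < ‖z‖ := norm_pos_iff.mpr h0
  have h2 : (0 : ℝ) < n := by rw [← hn]; positivity
  have h3 : (1 : ℝ) ≤ n := by exact_mod_cast h2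
  nlinarith

lemma IsQI.coords {O : Subring ℂ} (h : IsQI O) : ∃ (D : ℕ) (σ : ℝ), Squarefree D ∧ 0 < D ∧
    σ ^ 2 = D ∧ ∀ z ∈ O, ∃ t k : ℤ, 2 * z.re = t ∧ 2 * z.im = k * σ ∧ (4 : ℤ) ∣ t ^ 2 + D * k ^ 2 := by
  have im2 : ∀ z ∈ O, ∃ U : ℤ, (2 * z.im) ^ 2 = U := by
    intro z hz
    obtain ⟨t, ht⟩ := h.tr z hz
    obtain ⟨n, hn⟩ := h.nm z hz
    refine ⟨4 * n - t ^ 2, ?_⟩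
    push_cast
    rw [← ht, ← hn, ← Complex.normSq_eq_norm_sq, Complex.normSq_apply]; ring
  have imim : ∀ z ∈ O, ∀ w ∈ O, ∃ j : ℤ, (2 * z.im) * (2 * w.im) = j := by
    intro z hz w hw
    obtain ⟨t, ht⟩ := h.tr z hz
    obtain ⟨t', ht'⟩ := h.tr w hw
    obtain ⟨n, hn⟩ := h.nm z hz
    obtain ⟨n', hn'⟩ := h.nm w hw
    obtain ⟨n'', hn''⟩ := h.nm (z + w) (O.add_mem hz hw)
    refine ⟨2 * (n'' - n - n') - t * t', ?_⟩
    push_cast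
    rw [← ht, ← ht', ← hn, ← hn', ← hn'']
    simp only [← Complex.normSq_eq_norm_sq, Complex.normSq_apply, Complex.add_re, Complex.add_im]
    ring
  obtain ⟨w, hw, hwi⟩ := h.nr
  obtain ⟨M, hM⟩ := im2 w hw
  have hMpos : 0 < M := by
    have : (0 : ℝ) < M := by rw [← hM]; positivity
    exact_mod_cast this
  lift M to ℕ using hMpos.le
  obtain ⟨D, f, hD, hf, hDf, hsq⟩ := Nat.sq_mul_squarefree_of_pos (n := M) (by exact_mod_cast hMpos)
  have hfR : (f : ℝ) ≠ 0 := by positivity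
  have hMR : (2 * w.im) ^ 2 = (f : ℝ) ^ 2 * D := by rw [hM, ← hDf]; push_cast; rfl
  refine ⟨D, 2 * w.im / f, hsq, hD, ?_, ?_⟩
  · rw [div_pow, hMR]; field_simp
  · intro z hz
    obtain ⟨t, ht⟩ := h.tr z hz
    obtain ⟨n, hn⟩ := h.nm z hz
    obtain ⟨U, hU⟩ := im2 z hz
    obtain ⟨j, hj⟩ := imim z hz w hw
    have hjj : j ^ 2 = U * (f ^ 2 * D) := by
      have : (j : ℝ) ^ 2 = U * (f ^ 2 * D) := by rw [← hj, ← hU, ← hMR]; ring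
      exact_mod_cast this
    have hfj : (f : ℤ) ∣ j := by
      rw [← Int.pow_dvd_pow_iff (two_ne_zero)]
      exact ⟨U * D, by rw [hjj]; ring⟩
    obtain ⟨k', rfl⟩ := hfj
    have hk' : k' ^ 2 = U * D := by
      have hf2 : (f : ℤ) ^ 2 ≠ 0 := by positivity
      apply mul_left_cancel₀ hf2
      linear_combination hjj
    have hDk : (D : ℤ) ∣ k' := by
      have hsqZ : Squarefree (D : ℤ) := Int.squarefree_natCast.mpr hsq
      exact (hsqZ.dvd_pow_iff_dvd two_ne_zero).mp ⟨U, by rw [hk']; ring⟩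
    obtain ⟨k, rfl⟩ := hDk
    have hDR : (D : ℝ) ≠ 0 := by positivity
    have hUk : U = D * k ^ 2 := by
      have hD0 : (D : ℤ) ≠ 0 := by positivity
      apply mul_left_cancel₀ hD0
      linear_combination -hk'
    refine ⟨t, k, ht, ?_, ⟨n, ?_⟩⟩
    · have hw2 : 2 * w.im ≠ 0 := by simpa using hwi
      apply mul_right_cancel₀ hw2
      rw [hj]; push_cast
      field_simp
      linear_combination (-(k : ℝ)) * hMR
    · have : (t : ℝ) ^ 2 + D * k ^ 2 = 4 * n := by
        have hUR : (U : ℝ) = D * k ^ 2 := by exact_mod_cast hUk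
        rw [← hUR, ← hU, ← ht, ← hn, ← Complex.normSq_eq_norm_sq, Complex.normSq_apply]; ring
      exact_mod_cast this

end DTup

namespace DTup

/-- small coordinate pairs -/
noncomputable def FD (D : ℕ) : Finset (ℤ × ℤ) :=
  (Finset.Icc (-5 : ℤ) 5 ×ˢ Finset.Icc (-5 : ℤ) 5).filter
    (fun v => v ≠ 0 ∧ v.1 ^ 2 + D * v.2 ^ 2 ≤ 32 ∧ (4 : ℤ) ∣ v.1 ^ 2 + D * v.2 ^ 2)

noncomputable def box : Finset (ℤ × ℤ) := Finset.Icc (-6 : ℤ) 6 ×ˢ Finset.Icc (-6 : ℤ) 6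

/-- pairs for which `v` and `-v` may be compatible -/
def exc (D : ℕ) (v : ℤ × ℤ) : Prop := ∃ p ∈ box,
  -(v.1 ^ 2 - D * v.2 ^ 2) - 4 = p.1 ^ 2 - D * p.2 ^ 2 ∧ - v.1 * v.2 = p.1 * p.2

noncomputable instance (D : ℕ) (v : ℤ × ℤ) : Decidable (exc D v) := by unfold exc; infer_instance

lemma card_reg : ∀ D ∈ Finset.Icc 1 32, ¬ 4 ∣ D → D ≠ 1 → D ≠ 3 → D ≠ 7 → (FD D).card ≤ 17 := by
  decide +kernel

lemma card_exc : ∀ D ∈ ({1, 3, 7} : Finset ℕ),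
    2 * ((FD D).filter (fun v => exc D v)).card + ((FD D).filter (fun v => ¬ exc D v)).card ≤ 35 := by
  decide +kernel



lemma int_bound {m : ℤ} {c : ℕ} (n : ℤ) (h : m ^ 2 < ((c : ℤ) + 1) ^ 2) (hn : n = c) : m ∈ Finset.Icc (-n) n := by
  subst hn
  have := abs_lt_of_sq_lt_sq h (by positivity)
  rw [abs_lt] at this
  rw [Finset.mem_Icc]; omega

lemma small_bound {O : Subring ℂ} (h : IsQI O) (T : Finset ℂ)
    (hT : ∀ a ∈ T, a ∈ O ∧ a ≠ 0 ∧ ‖a‖ < 3)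
    (hP : ∀ a ∈ T, ∀ b ∈ T, a ≠ b → ∃ x ∈ O, a * b - 1 = x ^ 2) : T.card ≤ 17 := by
  obtain ⟨D, σ, hsq, hD, hσ, hc⟩ := h.coords
  have hD0 : (0 : ℝ) < D := by exact_mod_cast hD
  have hσ0 : σ ≠ 0 := by rintro rfl; norm_num at hσ; linarith
  choose! t k ht hk h4 using hc
  set φ : ℂ → ℤ × ℤ := fun z => (t z, k z) with hφ
  have hinj : ∀ a ∈ O, ∀ b ∈ O, φ a = φ b → a = b := by
    intro a ha b hb e
    simp only [hφ, Prod.mk.injEq] at e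
    apply Complex.ext
    · have h1 := ht a ha; have h2 := ht b hb
      rw [e.1] at h1; linarith
    · have h1 := hk a ha; have h2 := hk b hb
      rw [e.2] at h1; linarith
  have hnorm : ∀ a ∈ O, (t a : ℝ) ^ 2 + D * (k a : ℝ) ^ 2 = 4 * ‖a‖ ^ 2 := by
    intro a ha
    rw [← Complex.normSq_eq_norm_sq, Complex.normSq_apply, ← hσ, ← ht a ha]
    have := hk a ha
    linear_combination (-(k a * σ) - 2 * a.im) * this
  have hDZ : (1 : ℤ) ≤ D := by exact_mod_cast hD
  have hFD : ∀ a ∈ T, φ a ∈ FD D := by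
    intro a ha
    obtain ⟨haO, ha0, ha3⟩ := hT a ha
    have h32 : t a ^ 2 + D * k a ^ 2 ≤ 32 := by
      obtain ⟨q, hq⟩ := h4 a haO
      have : (t a : ℝ) ^ 2 + D * (k a : ℝ) ^ 2 < 36 := by
        rw [hnorm a haO]; nlinarith [norm_nonneg a]
      have h' : t a ^ 2 + D * k a ^ 2 < 36 := by exact_mod_cast this
      omega
    have hk2 := sq_nonneg (k a)
    have ht2 := sq_nonneg (t a)
    have hkk : k a ^ 2 ≤ D * k a ^ 2 := by nlinarith
    unfold FD
    rw [Finset.mem_filter, Finset.mem_product]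
    refine ⟨⟨?_, ?_⟩, ?_, h32, h4 a haO⟩
    · exact int_bound (c := 5) 5 (by norm_num; linarith) rfl
    · exact int_bound (c := 5) 5 (by norm_num; linarith) rfl
    · intro h0
      simp only [hφ, Prod.mk_eq_zero] at h0
      apply ha0
      apply norm_eq_zero.mp
      have := hnorm a haO
      rw [h0.1, h0.2] at this
      have : ‖a‖ ^ 2 = 0 := by norm_num at this; simp [this]
      simpa using this
  have hinjT : Set.InjOn φ T := fun a ha b hb e => hinj a (hT a ha).1 b (hT b hb).1 e
  have hcard : (T.image φ).card = T.card := Finset.card_image_of_injOn hinjT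
  set A := T.image φ with hA
  have hAF : A ⊆ FD D := by
    intro v hv
    obtain ⟨a, ha, rfl⟩ := Finset.mem_image.mp hv
    exact hFD a ha
  rw [← hcard]
  by_cases hbig : 32 < D
  · -- only k = 0
    have hsub : A ⊆ ({(-4, 0), (-2, 0), (2, 0), (4, 0)} : Finset (ℤ × ℤ)) := by
      intro v hv
      have hv := hAF hv
      obtain ⟨v1, v2⟩ := v
      unfold FD at hv
      rw [Finset.mem_filter, Finset.mem_product] at hv
      obtain ⟨⟨h1, _⟩, h2, h3, h5⟩ := hv
      simp only at h1 h3 h5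
      have hv2 : v2 = 0 := by
        by_contra hne
        have : 1 ≤ v2 ^ 2 := by have := sq_pos_of_ne_zero hne; omega
        have hDb : (33 : ℤ) ≤ D := by exact_mod_cast hbig
        nlinarith [sq_nonneg v1]
      subst hv2
      rw [Finset.mem_Icc] at h1
      obtain ⟨l, u⟩ := h1
      interval_cases v1 <;> simp_all
    exact (Finset.card_le_card hsub).trans (by decide)
  · push Not at hbig
    have h4D : ¬ 4 ∣ D := by
      intro h4D
      have : IsUnit 2 := hsq 2 (by simpa using h4D)
      simp at this
    by_cases hs : D = 1 ∨ D = 3 ∨ D = 7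
    · have hce := card_exc D (by simpa using hs)
      set E := (FD D).filter (fun v => exc D v)
      set F := (FD D).filter (fun v => ¬ exc D v) with hF
      have hsplit : A.card = (A.filter (fun v => exc D v)).card + (A.filter (fun v => ¬ exc D v)).card :=
        (Finset.card_filter_add_card_filter_not _).symm
      have h1 : (A.filter (fun v => exc D v)).card ≤ E.card :=
        Finset.card_le_card (Finset.filter_subset_filter _ hAF)
      set A' := A.filter (fun v => ¬ exc D v) with hA'
      have hA'F : A' ⊆ F := Finset.filter_subset_filter _ hAF
      have hnegF : A'.image (fun v => -v) ⊆ F := by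
        intro v hv
        obtain ⟨u, hu, rfl⟩ := Finset.mem_image.mp hv
        have hu := hA'F hu
        rw [hF, Finset.mem_filter] at hu ⊢
        refine ⟨?_, ?_⟩
        · have hu1 := hu.1
          unfold FD at hu1 ⊢
          rw [Finset.mem_filter, Finset.mem_product, Finset.mem_Icc, Finset.mem_Icc] at hu1 ⊢
          simp only [Prod.fst_neg, Prod.snd_neg, neg_sq, ne_eq, neg_eq_zero]
          refine ⟨⟨?_, ?_⟩, hu1.2⟩ <;> omega
        · have := hu.2
          unfold exc at this ⊢
          simpa using this
      have hdisj : Disjoint A' (A'.image (fun v => -v)) := by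
        rw [Finset.disjoint_left]
        intro v hv hv'
        obtain ⟨u, hu, rfl⟩ := Finset.mem_image.mp hv'
        obtain ⟨hu1, hu2⟩ := Finset.mem_filter.mp hu
        obtain ⟨hv1, -⟩ := Finset.mem_filter.mp hv
        obtain ⟨a, ha, rfl⟩ := Finset.mem_image.mp hu1
        obtain ⟨b, hb, hbe⟩ := Finset.mem_image.mp hv1
        obtain ⟨haO, ha0, ha3⟩ := hT a ha
        obtain ⟨hbO, hb0, hb3⟩ := hT b hb
        have hba : b = -a := by
          simp only [hφ, Prod.neg_mk, Prod.mk.injEq] at hbe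
          have e1 : (t b : ℝ) = -(t a : ℝ) := by exact_mod_cast hbe.1
          have e2 : (k b : ℝ) = -(k a : ℝ) := by exact_mod_cast hbe.2
          apply Complex.ext
          · have h1 := ht a haO; have h2 := ht b hbO
            rw [Complex.neg_re]; linarith
          · have h1 := hk a haO; have h2 := hk b hbO
            rw [e2] at h2
            rw [Complex.neg_im]; linarith
        obtain ⟨x, hxO, hx⟩ := hP a ha b hb (by
          rw [hba]; intro e; apply ha0; linear_combination (1 / 2 : ℂ) * e)
        rw [hba] at hx
        apply hu2
        have hre := congrArg Complex.re hx
        have him := congrArg Complex.im hx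
        simp [pow_two] at hre him
        have ta := ht a haO; have ka := hk a haO
        have tx := ht x hxO; have kx := hk x hxO
        have q1 : -((t a : ℝ) ^ 2 - D * (k a : ℝ) ^ 2) - 4 = (t x : ℝ) ^ 2 - D * (k x : ℝ) ^ 2 := by
          have sa : (D : ℝ) * (k a : ℝ) ^ 2 = (2 * a.im) ^ 2 := by rw [ka, ← hσ]; ring
          have sx : (D : ℝ) * (k x : ℝ) ^ 2 = (2 * x.im) ^ 2 := by rw [kx, ← hσ]; ring
          rw [sa, sx, ← ta, ← tx]; linarith
        have q2 : -(t a : ℝ) * (k a : ℝ) = (t x : ℝ) * (k x : ℝ) := by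
          apply mul_right_cancel₀ hσ0
          rw [mul_assoc, mul_assoc, ← ka, ← kx, ← ta, ← tx]; linarith
        have q3 : (t x : ℝ) ^ 2 + D * (k x : ℝ) ^ 2 < 49 := by
          rw [hnorm x hxO, ← norm_pow, ← hx]
          have := norm_sub_le (a * -a) 1
          rw [norm_mul, norm_neg, norm_one] at this
          nlinarith [norm_nonneg a]
        have q1' : -((t a) ^ 2 - D * (k a) ^ 2) - 4 = (t x) ^ 2 - D * (k x) ^ 2 := by exact_mod_cast q1
        have q2' : -(t a) * (k a) = (t x) * (k x) := by exact_mod_cast q2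
        have q3' : (t x) ^ 2 + D * (k x) ^ 2 < 49 := by exact_mod_cast q3
        have hk2 := sq_nonneg (k x)
        have ht2 := sq_nonneg (t x)
        have hkk : k x ^ 2 ≤ D * k x ^ 2 := by nlinarith
        refine ⟨(t x, k x), ?_, q1', q2'⟩
        unfold box
        rw [Finset.mem_product]
        exact ⟨int_bound (c := 6) 6 (by norm_num; linarith) rfl,
          int_bound (c := 6) 6 (by norm_num; linarith) rfl⟩
      have h2 := Finset.card_le_card (Finset.union_subset hA'F hnegF)
      rw [Finset.card_union_of_disjoint hdisj, Finset.card_image_of_injective _ neg_injective] at h2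
      omega
    · push Not at hs
      exact (Finset.card_le_card hAF).trans
        (card_reg D (by rw [Finset.mem_Icc]; omega) h4D hs.1 hs.2.1 hs.2.2)

end DTup

namespace DTup

lemma gap_real (X Y Z : ℝ) (hX : 3 ≤ X) (hXY : X ≤ Y) (hYZ : Y ≤ Z)
    (h : 4 * X * Y * Z ≤ (X + Y + Z + 1) ^ 2 + 4) : 2 * X * Y ≤ Z := by
  by_contra hcon
  push Not at hcon
  have hY : 3 ≤ Y := by linarith
  have h1 : 0 ≤ (Z - Y) * (2 * X * Y - Z) := mul_nonneg (by linarith) (by linarith)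
  -- endpoint Z = Y
  have f1 : (X + Y + Y + 1) ^ 2 + 4 - 4 * X * Y * Y < 0 := by
    have a0 : 0 ≤ (X - 3) * (Y - X) := mul_nonneg (by linarith) (by linarith)
    have a1 : 0 ≤ (X - 3) * (Y - 3) := mul_nonneg (by linarith) (by linarith)
    have a2 : 0 ≤ (X - 3) * (Y - 3) * Y := mul_nonneg a1 (by linarith)
    nlinarith
  -- endpoint Z = 2 X Y
  have hs : 9 * (X + Y + 1) ≤ 7 * (X * Y) := by nlinarith
  have hp : 9 ≤ X * Y := by nlinarith
  have f2 : (X + Y + 2 * X * Y + 1) ^ 2 + 4 - 4 * X * Y * (2 * X * Y) < 0 := by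
    have : X + Y + 2 * X * Y + 1 ≤ 25 / 9 * (X * Y) := by linarith
    have h2 : (X + Y + 2 * X * Y + 1) ^ 2 ≤ (25 / 9 * (X * Y)) ^ 2 := by gcongr
    nlinarith
  -- convexity
  have hd : 0 < 2 * X * Y - Y := by nlinarith
  have key : (2 * X * Y - Y) * ((X + Y + Z + 1) ^ 2 + 4 - 4 * X * Y * Z) =
      (2 * X * Y - Z) * ((X + Y + Y + 1) ^ 2 + 4 - 4 * X * Y * Y)
      + (Z - Y) * ((X + Y + 2 * X * Y + 1) ^ 2 + 4 - 4 * X * Y * (2 * X * Y))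
      - (2 * X * Y - Y) * ((Z - Y) * (2 * X * Y - Z)) := by ring
  have t1 : (2 * X * Y - Z) * ((X + Y + Y + 1) ^ 2 + 4 - 4 * X * Y * Y) < 0 :=
    mul_neg_of_pos_of_neg (by linarith) f1
  have t2 : (Z - Y) * ((X + Y + 2 * X * Y + 1) ^ 2 + 4 - 4 * X * Y * (2 * X * Y)) ≤ 0 :=
    mul_nonpos_of_nonneg_of_nonpos (by linarith) f2.le
  have t3 : 0 ≤ (2 * X * Y - Y) * ((Z - Y) * (2 * X * Y - Z)) := mul_nonneg hd.le h1
  have t4 : 0 ≤ (2 * X * Y - Y) * ((X + Y + Z + 1) ^ 2 + 4 - 4 * X * Y * Z) :=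
    mul_nonneg hd.le (by linarith)
  linarith

def PP (x y z : ℂ) : ℂ := x ^ 2 + y ^ 2 + z ^ 2 - 2 * (x * y + y * z + z * x) + 4

lemma gap_ne (O : Subring ℂ) (hO : ∀ z ∈ O, z ≠ 0 → 1 ≤ ‖z‖) (x y z r s t : ℂ)
    (hx : x ∈ O) (hy : y ∈ O) (hz : z ∈ O) (hr : r ∈ O) (hs : s ∈ O) (ht : t ∈ O)
    (er : x * y - 1 = r ^ 2) (es : x * z - 1 = s ^ 2) (et : y * z - 1 = t ^ 2)
    (h3 : 3 ≤ ‖x‖) (hxy : ‖x‖ ≤ ‖y‖) (hyz : ‖y‖ ≤ ‖z‖) (hP : PP x y z ≠ 0) :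
    2 * ‖x‖ * ‖y‖ ≤ ‖z‖ := by
  set e1 := 2 * (x * y * z) - (x + y + z) - 2 * (r * s * t) with he1
  set e2 := 2 * (x * y * z) - (x + y + z) + 2 * (r * s * t) with he2
  have hprod : e1 * e2 = PP x y z := by
    have : e1 * e2 = (2 * (x * y * z) - (x + y + z)) ^ 2 - 4 * (r ^ 2 * s ^ 2 * t ^ 2) := by
      rw [he1, he2]; ring
    rw [this, ← er, ← es, ← et, PP]; ring
  have h2 : (2 : ℂ) ∈ O := by simpa using natCast_mem O 2
  have m1 : 2 * (x * y * z) - (x + y + z) ∈ O :=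
    O.sub_mem (O.mul_mem h2 (O.mul_mem (O.mul_mem hx hy) hz)) (O.add_mem (O.add_mem hx hy) hz)
  have m2 : 2 * (r * s * t) ∈ O := O.mul_mem h2 (O.mul_mem (O.mul_mem hr hs) ht)
  have n1 : 1 ≤ ‖e1‖ := hO _ (O.sub_mem m1 m2) (by
    intro h; apply hP; rw [← hprod, h, zero_mul])
  have n2 : 1 ≤ ‖e2‖ := hO _ (O.add_mem m1 m2) (by
    intro h; apply hP; rw [← hprod, h, mul_zero])
  have hPn : ‖e1‖ * ‖e2‖ ≤ (‖x‖ + ‖y‖ + ‖z‖) ^ 2 + 4 := by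
    rw [← norm_mul, hprod, PP]
    have c4 : ‖(4 : ℂ)‖ = 4 := by norm_num
    have c2 : ‖(2 : ℂ)‖ = 2 := by norm_num
    have b1 := norm_add_le (x ^ 2 + y ^ 2 + z ^ 2 - 2 * (x * y + y * z + z * x)) 4
    have b2 := norm_sub_le (x ^ 2 + y ^ 2 + z ^ 2) (2 * (x * y + y * z + z * x))
    have b3 := norm_add₃_le (a := x ^ 2) (b := y ^ 2) (c := z ^ 2)
    have b4 := norm_add₃_le (a := x * y) (b := y * z) (c := z * x)
    rw [norm_mul 2, c2] at b2
    rw [c4] at b1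
    simp only [norm_pow, norm_mul] at b3 b4
    nlinarith
  have hsum : 4 * ‖x‖ * ‖y‖ * ‖z‖ ≤ ‖e1‖ + ‖e2‖ + 2 * (‖x‖ + ‖y‖ + ‖z‖) := by
    have c4 : ‖(4 : ℂ)‖ = 4 := by norm_num
    have c2 : ‖(2 : ℂ)‖ = 2 := by norm_num
    have e : 4 * x * y * z = (e1 + e2) + 2 * (x + y + z) := by rw [he1, he2]; ring
    have b := congrArg norm e
    rw [norm_mul, norm_mul, norm_mul, c4] at b
    have b1 := norm_add_le (e1 + e2) (2 * (x + y + z))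
    have b2 := norm_add_le e1 e2
    have b3 := norm_add₃_le (a := x) (b := y) (c := z)
    rw [norm_mul, c2] at b1
    linarith
  apply gap_real _ _ _ h3 hxy hyz
  nlinarith [mul_nonneg (sub_nonneg.mpr n1) (sub_nonneg.mpr n2)]

lemma gap_eq (x y z : ℂ) (hy : 1 ≤ ‖y‖) (hxy : ‖x‖ ≤ ‖y‖) (hP : PP x y z = 0) : ‖z‖ < 6 * ‖y‖ := by
  by_contra hcon
  push Not at hcon
  have c4 : ‖(4 : ℂ)‖ = 4 := by norm_num
  have c2 : ‖(2 : ℂ)‖ = 2 := by norm_num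
  have e : z ^ 2 = 2 * (x * y + y * z + z * x) - (x ^ 2 + y ^ 2 + 4) := by
    rw [PP] at hP; linear_combination hP
  have b := congrArg norm e
  have b1 := norm_sub_le (2 * (x * y + y * z + z * x)) (x ^ 2 + y ^ 2 + 4)
  have b2 := norm_add₃_le (a := x ^ 2) (b := y ^ 2) (c := 4)
  have b3 := norm_add₃_le (a := x * y) (b := y * z) (c := z * x)
  rw [norm_mul 2, c2] at b1
  rw [c4] at b2
  simp only [norm_pow, norm_mul] at b b2 b3
  have h0 := norm_nonneg x
  have h1 := norm_nonneg z
  have : ‖z‖ ^ 2 ≤ 4 * ‖y‖ ^ 2 + 4 * (‖y‖ * ‖z‖) + 4 := by nlinarith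
  nlinarith

lemma gap5 (O : Subring ℂ) (hO : ∀ z ∈ O, z ≠ 0 → 1 ≤ ‖z‖) (S : Finset ℂ) (hS : ∀ a ∈ S, a ∈ O)
    (hP : ∀ a ∈ S, ∀ b ∈ S, a ≠ b → ∃ x ∈ O, a * b - 1 = x ^ 2)
    (x : Fin 3 → ℂ) (hxi : Function.Injective x) (y z : ℂ) (hx : ∀ i, x i ∈ S) (hy : y ∈ S) (hz : z ∈ S)
    (hxy : ∀ i, x i ≠ y) (hxz : ∀ i, x i ≠ z) (hyz : y ≠ z)
    (h3 : ∀ i, 3 ≤ ‖x i‖) (nxy : ∀ i, ‖x i‖ ≤ ‖y‖) (nyz : ‖y‖ ≤ ‖z‖) (i : Fin 3) :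
    2 * ‖x i‖ * ‖y‖ ≤ ‖z‖ := by
  have key : ∀ i, PP (x i) y z ≠ 0 → 2 * ‖x i‖ * ‖y‖ ≤ ‖z‖ := by
    intro i hne
    obtain ⟨r, hr, er⟩ := hP _ (hx i) _ hy (hxy i)
    obtain ⟨s, hs, es⟩ := hP _ (hx i) _ hz (hxz i)
    obtain ⟨t, ht, et⟩ := hP _ hy _ hz hyz
    exact gap_ne O hO (x i) y z r s t (hS _ (hx i)) (hS _ hy) (hS _ hz) hr hs ht er es et (h3 i) (nxy i) nyz hne
  have hy3 : 3 ≤ ‖y‖ := (h3 0).trans (nxy 0)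
  have hex : ∃ i, PP (x i) y z ≠ 0 := by
    by_contra hcon
    push Not at hcon
    have h0 := hcon 0
    have h1 := hcon 1
    have h2 := hcon 2
    unfold PP at h0 h1 h2
    have n01 : x 0 - x 1 ≠ 0 := sub_ne_zero.mpr fun e => by simpa using hxi e
    have n02 : x 0 - x 2 ≠ 0 := sub_ne_zero.mpr fun e => by simpa using hxi e
    have n12 : x 1 ≠ x 2 := fun e => by simpa using hxi e
    have q1 : x 0 + x 1 - 2 * (y + z) = 0 := by
      apply mul_left_cancel₀ n01; linear_combination h0 - h1
    have q2 : x 0 + x 2 - 2 * (y + z) = 0 := by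
      apply mul_left_cancel₀ n02; linear_combination h0 - h2
    exact n12 (by linear_combination q1 - q2)
  obtain ⟨i0, hi0⟩ := hex
  have hbig : 6 * ‖y‖ ≤ ‖z‖ := by
    have := key i0 hi0
    have := h3 i0
    nlinarith
  apply key i
  intro h0
  linarith [gap_eq (x i) y z (by linarith) (nxy i) h0]

lemma fib_growth (A : ℕ → ℝ) (B : ℝ) (hB : 1 ≤ B) (n : ℕ) (h0 : B ≤ A n) (h1 : B ≤ A (n + 1))
    (L : ℕ) (h : ∀ i, i < L → 2 * A (n + i) * A (n + i + 1) ≤ A (n + i + 2)) (i : ℕ) (hi : i ≤ L) :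
    B ^ Nat.fib (i + 1) ≤ A (n + i) ∧ B ^ Nat.fib (i + 2) ≤ A (n + i + 1) := by
  induction i with
  | zero => simpa using ⟨h0, h1⟩
  | succ i ih =>
    obtain ⟨a1, a2⟩ := ih (by omega)
    refine ⟨a2, ?_⟩
    have hg := h i (by omega)
    have e : Nat.fib (i + 1 + 2) = Nat.fib (i + 1) + Nat.fib (i + 2) := Nat.fib_add_two
    rw [e, pow_add]
    have p1 : 0 < B ^ Nat.fib (i + 1) := by positivity
    have p2 : 0 < B ^ Nat.fib (i + 2) := by positivity
    have m : B ^ Nat.fib (i + 1) * B ^ Nat.fib (i + 2) ≤ A (n + i) * A (n + i + 1) :=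
      mul_le_mul a1 a2 p2.le (p1.le.trans a1)
    have : A (n + (i + 1) + 1) = A (n + i + 2) := by congr 1
    rw [this]
    nlinarith [mul_pos p1 p2]

lemma large_bound (O : Subring ℂ) (hO : ∀ z ∈ O, z ≠ 0 → 1 ≤ ‖z‖) (S : Finset ℂ)
    (hS : ∀ a ∈ S, a ∈ O) (h3 : ∀ a ∈ S, 3 ≤ ‖a‖)
    (hP : ∀ a ∈ S, ∀ b ∈ S, a ≠ b → ∃ x ∈ O, a * b - 1 = x ^ 2) : S.card < 20 := by
  by_contra hcon
  push Not at hcon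
  obtain ⟨S', hS', hc⟩ := Finset.exists_subset_card_eq hcon
  let g : Fin 20 → ℂ := fun i => ((S'.equivFinOfCardEq hc).symm i : ℂ)
  have hg : ∀ i, g i ∈ S := fun i => hS' ((S'.equivFinOfCardEq hc).symm i).2
  have hgi : Function.Injective g := Subtype.val_injective.comp (Equiv.injective _)
  let f : Fin 20 → ℂ := g ∘ Tuple.sort (fun i => ‖g i‖)
  have hmono : Monotone (fun i => ‖f i‖) := Tuple.monotone_sort (fun i => ‖g i‖)
  have hfi : Function.Injective f := hgi.comp (Equiv.injective _)
  have hf : ∀ i, f i ∈ S := fun i => hg _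
  let E : ℕ → ℂ := fun n => if h : n < 20 then f ⟨n, h⟩ else 0
  have hE : ∀ n, (h : n < 20) → E n = f ⟨n, h⟩ := fun n h => by simp [E, h]
  have hES : ∀ n, n < 20 → E n ∈ S := fun n h => by rw [hE n h]; exact hf _
  have hEne : ∀ m n, m < n → n < 20 → E m ≠ E n := by
    intro m n hmn hn
    rw [hE m (by omega), hE n hn]
    intro e
    have := hfi e
    simp at this; omega
  have hEle : ∀ m n, m ≤ n → n < 20 → ‖E m‖ ≤ ‖E n‖ := by
    intro m n hmn hn
    rw [hE m (by omega), hE n hn]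
    exact hmono (by simpa using hmn)
  have gap : ∀ n, n + 4 < 20 → 2 * ‖E (n + 2)‖ * ‖E (n + 3)‖ ≤ ‖E (n + 4)‖ := by
    intro n hn
    have := gap5 O hO S hS hP (fun i : Fin 3 => E (n + i)) (by
        intro i j e
        by_contra hij
        rcases lt_or_gt_of_ne hij with h | h
        · exact hEne (n + i) (n + j) (by have : (i : ℕ) < j := h; omega) (by omega) e
        · exact hEne (n + j) (n + i) (by have : (j : ℕ) < i := h; omega) (by omega) e.symm)
      (E (n + 3)) (E (n + 4)) (fun i => hES _ (by omega)) (hES _ (by omega)) (hES _ (by omega))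
      (fun i => hEne _ _ (by omega) (by omega)) (fun i => hEne _ _ (by omega) (by omega))
      (hEne _ _ (by omega) (by omega)) (fun i => h3 _ (hES _ (by omega)))
      (fun i => hEle _ _ (by omega) (by omega)) (hEle _ _ (by omega) (by omega)) 2
    exact this
  have hB : 18 ≤ ‖E 4‖ := by
    have := gap 0 (by norm_num)
    have a2 := h3 _ (hES 2 (by norm_num))
    have a3 := h3 _ (hES 3 (by norm_num))
    simp only [zero_add] at this
    nlinarith
  have gC := (fib_growth (fun n => ‖E n‖) ‖E 4‖ (by linarith) 4 le_rfl
    (hEle 4 5 (by norm_num) (by norm_num)) 8 (fun i hi => by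
      have := gap (i + 2) (by omega)
      have e1 : i + 2 + 2 = 4 + i := by ring
      have e2 : i + 2 + 3 = 4 + i + 1 := by ring
      have e3 : i + 2 + 4 = 4 + i + 2 := by ring
      rw [e1, e2, e3] at this
      exact this) 8 le_rfl).1
  have hC : ‖E 4‖ ^ 34 ≤ ‖E 12‖ := by
    have e : Nat.fib (8 + 1) = 34 := by norm_num
    rw [e] at gC; exact gC
  have gD := (fib_growth (fun n => ‖E n‖) ‖E 12‖ (by linarith [hEle 4 12 (by norm_num) (by norm_num)]) 12 le_rfl
    (hEle 12 13 (by norm_num) (by norm_num)) 6 (fun i hi => by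
      have := gap (i + 10) (by omega)
      have e1 : i + 10 + 2 = 12 + i := by ring
      have e2 : i + 10 + 3 = 12 + i + 1 := by ring
      have e3 : i + 10 + 4 = 12 + i + 2 := by ring
      rw [e1, e2, e3] at this
      exact this) 6 le_rfl).2
  have hD : ‖E 12‖ ^ 21 ≤ ‖E 19‖ := by
    have e : Nat.fib (6 + 2) = 21 := by norm_num
    rw [e] at gD; exact gD
  have m3 := hES 3 (by norm_num)
  have m4 := hES 4 (by norm_num)
  have m12 := hES 12 (by norm_num)
  have m19 := hES 19 (by norm_num)
  obtain ⟨s, hs, es⟩ := hP _ m3 _ m12 (hEne _ _ (by norm_num) (by norm_num))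
  obtain ⟨t, ht, et⟩ := hP _ m4 _ m12 (hEne _ _ (by norm_num) (by norm_num))
  obtain ⟨x, hx, ex⟩ := hP _ m3 _ m19 (hEne _ _ (by norm_num) (by norm_num))
  obtain ⟨y, hy, ey⟩ := hP _ m4 _ m19 (hEne _ _ (by norm_num) (by norm_num))
  obtain ⟨z, hz, ez⟩ := hP _ m12 _ m19 (hEne _ _ (by norm_num) (by norm_num))
  have ha0 : E 3 ≠ 0 := by
    intro h
    have := h3 _ m3
    rw [h] at this; norm_num at this
  exact rickert O hO (E 3) (E 4) (E 12) (E 19) s t x y z (hS _ m3) (hS _ m4) (hS _ m12) (hS _ m19)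
    hs ht hx hy hz ha0 (hEne _ _ (by norm_num) (by norm_num)) es.symm et.symm ex.symm ey.symm ez.symm
    hB (hEle _ _ (by norm_num) (by norm_num)) hC hD

theorem main (K : Subfield ℂ) (hdeg : Module.finrank ℚ K = 2) (him : ∃ z : K, (z : ℂ).im ≠ 0) :
    ¬∃ S : Finset K, 36 < S.card ∧
      (∀ a ∈ S, a ≠ 0 ∧ IsIntegral ℤ a) ∧
      (∀ a ∈ S, ∀ b ∈ S, a ≠ b → ∃ x : K, IsIntegral ℤ x ∧ a * b - 1 = x ^ 2) := by
  classical
  rintro ⟨S, hcard, hS, hP⟩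
  obtain ⟨w, hw⟩ := him
  have hQ := OK_isQI K hdeg w w.2 hw
  have intg : ∀ x : K, IsIntegral ℤ x → (x : ℂ) ∈ OK K := by
    intro x hx
    refine mem_OK.mpr ⟨x.2, ?_⟩
    exact hx.map (K.subtype.toIntAlgHom)
  let S' : Finset ℂ := S.image (fun a : K => (a : ℂ))
  have hS'card : S'.card = S.card := Finset.card_image_of_injective _ Subtype.val_injective
  have hS'O : ∀ a ∈ S', a ∈ OK K ∧ a ≠ 0 := by
    intro a ha
    obtain ⟨b, hb, rfl⟩ := Finset.mem_image.mp ha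
    refine ⟨intg b (hS b hb).2, ?_⟩
    simpa using (hS b hb).1
  have hP' : ∀ a ∈ S', ∀ b ∈ S', a ≠ b → ∃ x ∈ OK K, a * b - 1 = x ^ 2 := by
    intro a ha b hb hab
    obtain ⟨a, ha', rfl⟩ := Finset.mem_image.mp ha
    obtain ⟨b, hb', rfl⟩ := Finset.mem_image.mp hb
    obtain ⟨x, hx, e⟩ := hP a ha' b hb' (fun e => hab (by rw [e]))
    refine ⟨x, intg x hx, ?_⟩
    have := congrArg (fun z : K => (z : ℂ)) e
    simpa using this
  have hsmall := small_bound hQ (S'.filter (fun a => ‖a‖ < 3))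
    (fun a ha => by
      obtain ⟨h1, h2⟩ := Finset.mem_filter.mp ha
      exact ⟨(hS'O a h1).1, (hS'O a h1).2, h2⟩)
    (fun a ha b hb => hP' a (Finset.mem_filter.mp ha).1 b (Finset.mem_filter.mp hb).1)
  have hlarge := large_bound (OK K) hQ.one_le (S'.filter (fun a => ¬ ‖a‖ < 3))
    (fun a ha => (hS'O a (Finset.mem_filter.mp ha).1).1)
    (fun a ha => not_lt.mp (Finset.mem_filter.mp ha).2)
    (fun a ha b hb => hP' a (Finset.mem_filter.mp ha).1 b (Finset.mem_filter.mp hb).1)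
  have := Finset.card_filter_add_card_filter_not (s := S') (fun a => ‖a‖ < 3)
  omega

end DTup

/-- Main theorem: in the ring of integers of an imaginary quadratic field, there is no
Diophantine m-tuple with D(-1) for m > 36: no set of more than 36 nonzero elements of
O_K such that the product of any two distinct elements, minus 1, is a square in O_K. -/
theorem stmt_19 (K : Subfield ℂ)
    (hdeg : Module.finrank ℚ K = 2) (him : ∃ z : K, (z : ℂ).im ≠ 0) :
    ¬∃ S : Finset K, 36 < S.card ∧
      (∀ a ∈ S, a ≠ 0 ∧ IsIntegral ℤ a) ∧
      (∀ a ∈ S, ∀ b ∈ S, a ≠ b → ∃ x : K, IsIntegral ℤ x ∧ a * b - 1 = x ^ 2) := by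
  exact DTup.main K hdeg him
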